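/- arXiv:2211.02515 — 2 statements merged into one kernel-verified Lean document; each statement's English description precedes it below -/
import Mathlib

section
/- There is a positive absolute constant C such that the following holds. If Assumption (A) holds, then Σ_{D⁴ < n ≤ P²} ν(n)²/n ≤ C·𝓛^{-2011}. -/
open scoped Classical

noncomputable section

/-- The Dirichlet L-function of `χ` (extended to modulus `0` by `0`, a case never used below). -/
def Lfun {N : ℕ} (χ : DirichletCharacter ℂ N) (s : ℂ) : ℂ :=
  if h : N = 0 then 0
  else
    haveI : NeZero N := ⟨h⟩
    DirichletCharacter.LFunction χ s

/-- A Dirichlet character is *real* if all of its values are real numbers. -/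
def IsRealChar {N : ℕ} (χ : DirichletCharacter ℂ N) : Prop :=
  ∀ a : ZMod N, (χ a).im = 0

/-- `𝓛 = log D`. -/
def bigL (D : ℕ) : ℝ := Real.log D

/-- `P = exp (𝓛 ^ 9)`. -/
def bigP (D : ℕ) : ℝ := Real.exp (bigL D ^ 9)

/-- Assumption (A): `L(1, χ) < 𝓛 ^ (-2022)`. -/
def AssumptionA (D : ℕ) (χ : DirichletCharacter ℂ D) : Prop :=
  (Lfun χ 1).re < bigL D ^ (-2022 : ℤ)

/-- `p ~ P`, i.e. `p` is a prime with `P < p < P * (1 + 𝓛 ^ (-68))`. -/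
def SimP (D p : ℕ) : Prop :=
  p.Prime ∧ bigP D < (p : ℝ) ∧ (p : ℝ) < bigP D * (1 + bigL D ^ (-68 : ℤ))

/-- The finite set of primes `p ~ P`. -/
def primesP (D : ℕ) : Finset ℕ :=
  (Finset.range ⌈2 * bigP D⌉₊).filter (SimP D)

/-- `𝒫 = ∑_{p ~ P} p`. -/
def calP (D : ℕ) : ℝ := ∑ p ∈ primesP D, (p : ℝ)

/-- `ν(n) = ∑_{d ∣ n} χ(d)`. -/
def nuF (D : ℕ) (χ : DirichletCharacter ℂ D) (n : ℕ) : ℂ :=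
  ∑ d ∈ n.divisors, χ (d : ZMod D)

/-- `υ(n) = ∑_{ab = n} μ(a) μ(b) χ(b)`. -/
def upsF (D : ℕ) (χ : DirichletCharacter ℂ D) (n : ℕ) : ℂ :=
  ∑ d ∈ n.divisors,
    ((ArithmeticFunction.moebius (n / d) : ℤ) : ℂ) * ((ArithmeticFunction.moebius d : ℤ) : ℂ) *
      χ (d : ZMod D)

/-- `t₀ = 𝓛 ^ 519`. -/
def t0 (D : ℕ) : ℝ := bigL D ^ 519

/-- `s₀ = 1/2 + 2 π i t₀`. -/
def s0 (D : ℕ) : ℂ := 1 / 2 + 2 * (Real.pi : ℂ) * Complex.I * (t0 D : ℂ)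

/-- `𝓛₁ = 𝓛 ^ 405`. -/
def bigL1 (D : ℕ) : ℝ := bigL D ^ 405

/-- `ν` truncated to `n ≤ D ^ 4`, as an arithmetic function. -/
def nuT (D : ℕ) (χ : DirichletCharacter ℂ D) : ArithmeticFunction ℂ :=
  ⟨fun n => if n = 0 then 0 else if n ≤ D ^ 4 then nuF D χ n else 0, by simp⟩

/-- `υ` truncated to `n ≤ D ^ 4`, as an arithmetic function. -/
def upsT (D : ℕ) (χ : DirichletCharacter ℂ D) : ArithmeticFunction ℂ :=
  ⟨fun n => if n = 0 then 0 else if n ≤ D ^ 4 then upsF D χ n else 0, by simp⟩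

/-- `ν₂₀`, the 20-fold Dirichlet convolution of the truncation of `ν`. -/
def nu20 (D : ℕ) (χ : DirichletCharacter ℂ D) (n : ℕ) : ℂ := (nuT D χ ^ 20) n

/-- `υ₂₀`, the 20-fold Dirichlet convolution of the truncation of `υ`. -/
def ups20 (D : ℕ) (χ : DirichletCharacter ℂ D) (n : ℕ) : ℂ := (upsT D χ ^ 20) n

/-- `ς(n) = ∑_{lm = n, l ≤ D⁴, m ≤ D⁴} ν(l) υ(m)`. -/
def sigF (D : ℕ) (χ : DirichletCharacter ℂ D) (n : ℕ) : ℂ :=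
  ∑ d ∈ n.divisors,
    if d ≤ D ^ 4 ∧ n / d ≤ D ^ 4 then nuF D χ d * upsF D χ (n / d) else 0

/-- `X₁(x, ψ) = ∑_{n ≤ x} ν₂₀(n) ψ(n) n^{-s₀}`. -/
def X1 (D : ℕ) (χ : DirichletCharacter ℂ D) {p : ℕ} (ψ : DirichletCharacter ℂ p) (x : ℝ) : ℂ :=
  ∑ n ∈ Finset.Icc 1 ⌊x⌋₊, nu20 D χ n * ψ (n : ZMod p) * (n : ℂ) ^ (-s0 D)

/-- `X₂(x, ψ) = ∑_{n ≤ x} υ₂₀(n) ψ(n) n^{-s₀}`. -/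
def X2 (D : ℕ) (χ : DirichletCharacter ℂ D) {p : ℕ} (ψ : DirichletCharacter ℂ p) (x : ℝ) : ℂ :=
  ∑ n ∈ Finset.Icc 1 ⌊x⌋₊, ups20 D χ n * ψ (n : ZMod p) * (n : ℂ) ^ (-s0 D)

/-- `X₃(x, ψ) = ∑_{D⁴ < n ≤ x} ν(n) ψ(n) n^{-s₀}`. -/
def X3 (D : ℕ) (χ : DirichletCharacter ℂ D) {p : ℕ} (ψ : DirichletCharacter ℂ p) (x : ℝ) : ℂ :=
  ∑ n ∈ Finset.Ioc (D ^ 4) ⌊x⌋₊, nuF D χ n * ψ (n : ZMod p) * (n : ℂ) ^ (-s0 D)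

/-- `X₄(x, ψ) = ∑_{D⁴ < n ≤ x} ς(n) ψ(n) n^{-s₀}`. -/
def X4 (D : ℕ) (χ : DirichletCharacter ℂ D) {p : ℕ} (ψ : DirichletCharacter ℂ p) (x : ℝ) : ℂ :=
  ∑ n ∈ Finset.Ioc (D ^ 4) ⌊x⌋₊, sigF D χ n * ψ (n : ZMod p) * (n : ℂ) ^ (-s0 D)

/-- Inequality (3.4). -/
def Ineq1 (D : ℕ) (χ : DirichletCharacter ℂ D) {p : ℕ} (ψ : DirichletCharacter ℂ p) : Prop :=
  ‖X1 D χ ψ ((D : ℝ) ^ 80)‖ + ‖X2 D χ ψ ((D : ℝ) ^ 80)‖ +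
      (∫ x in (1 : ℝ)..((D : ℝ) ^ 80), (‖X1 D χ ψ x‖ + ‖X2 D χ ψ x‖) / x) <
    bigL D ^ 1171

/-- Inequality (3.5). -/
def Ineq2 (D : ℕ) (χ : DirichletCharacter ℂ D) {p : ℕ} (ψ : DirichletCharacter ℂ p) : Prop :=
  ‖X3 D χ ψ (bigP D ^ 2)‖ + (∫ x in ((D : ℝ) ^ 4)..(bigP D ^ 2), ‖X3 D χ ψ x‖ / x) <
    bigL D ^ (-585 : ℤ)

/-- Inequality (3.6). -/
def Ineq3 (D : ℕ) (χ : DirichletCharacter ℂ D) {p : ℕ} (ψ : DirichletCharacter ℂ p) : Prop :=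
  ‖X4 D χ ψ ((D : ℝ) ^ 8)‖ + (∫ x in ((D : ℝ) ^ 4)..((D : ℝ) ^ 8), ‖X4 D χ ψ x‖ / x) <
    bigL D ^ (-633 : ℤ)

/-- Membership in `Ψ₁`: `ψ` is a primitive character mod `p` with `p ~ P` satisfying
(3.4), (3.5) and (3.6). -/
def MemPsi1 (D : ℕ) (χ : DirichletCharacter ℂ D) {p : ℕ} (ψ : DirichletCharacter ℂ p) : Prop :=
  SimP D p ∧ ψ.IsPrimitive ∧ Ineq1 D χ ψ ∧ Ineq2 D χ ψ ∧ Ineq3 D χ ψ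

/-- `F(s, ψ) = ∑_{n ≤ D⁴} ν(n) ψ(n) n^{-s}`. -/
def Ffun (D : ℕ) (χ : DirichletCharacter ℂ D) {p : ℕ} (ψ : DirichletCharacter ℂ p) (s : ℂ) : ℂ :=
  ∑ n ∈ Finset.Icc 1 (D ^ 4), nuF D χ n * ψ (n : ZMod p) * (n : ℂ) ^ (-s)

/-- `G(s, ψ) = ∑_{n ≤ D⁴} υ(n) ψ(n) n^{-s}`. -/
def Gfun (D : ℕ) (χ : DirichletCharacter ℂ D) {p : ℕ} (ψ : DirichletCharacter ℂ p) (s : ℂ) : ℂ :=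
  ∑ n ∈ Finset.Icc 1 (D ^ 4), upsF D χ n * ψ (n : ZMod p) * (n : ℂ) ^ (-s)

/-- `F'(s, ψ) = -∑_{n ≤ D⁴} ν(n) ψ(n) (log n) n^{-s}`, the derivative of `F` in `s`. -/
def Ffun' (D : ℕ) (χ : DirichletCharacter ℂ D) {p : ℕ} (ψ : DirichletCharacter ℂ p) (s : ℂ) : ℂ :=
  -∑ n ∈ Finset.Icc 1 (D ^ 4),
    nuF D χ n * ψ (n : ZMod p) * ((Real.log n : ℝ) : ℂ) * (n : ℂ) ^ (-s)

/-- `F(1 - s, ψ̄) = ∑_{n ≤ D⁴} ν(n) conj(ψ(n)) n^{s - 1}`, as a function of `s`. -/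
def FfunBar (D : ℕ) (χ : DirichletCharacter ℂ D) {p : ℕ} (ψ : DirichletCharacter ℂ p)
    (s : ℂ) : ℂ :=
  ∑ n ∈ Finset.Icc 1 (D ^ 4),
    nuF D χ n * (starRingEnd ℂ) (ψ (n : ZMod p)) * (n : ℂ) ^ (s - 1)

/-- The region `Ω`. -/
def InOmega (D : ℕ) (s : ℂ) : Prop :=
  |(s - s0 D).re| < 1 / 2 ∧ |(s - s0 D).im| < bigL1 D + 2

/-- The region `Ω₁`. -/
def InOmega1 (D : ℕ) (s : ℂ) : Prop :=
  1 / 2 - Real.log (bigL D) / (100 * bigL D) < s.re ∧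
    s.re < 1 + Real.log (bigL D) / (100 * bigL D) ∧
    |s.im - 2 * Real.pi * t0 D| < bigL1 D + 5

/-- The region `Ω₂`. -/
def InOmega2 (D : ℕ) (s : ℂ) : Prop :=
  1 / 2 - (bigL D)⁻¹ < s.re ∧ s.re < 1 + (bigL D)⁻¹ ∧
    |s.im - 2 * Real.pi * t0 D| < bigL1 D + 4

/-- `α = π / log P`. -/
def alphaD (D : ℕ) : ℝ := Real.pi / Real.log (bigP D)

/-- The region `Ω₃`. -/
def InOmega3 (D : ℕ) (s : ℂ) : Prop :=
  1 / 2 - alphaD D < s.re ∧ s.re < 1 + alphaD D ∧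
    |s.im - 2 * Real.pi * t0 D| < bigL1 D + 3

/-- The Gauss sum `τ(θ) = ∑_{a mod k} θ(a) e(a/k)`. -/
def tauSum {k : ℕ} (θ : DirichletCharacter ℂ k) : ℂ :=
  ∑ a ∈ Finset.range k,
    θ (a : ZMod k) * Complex.exp (2 * (Real.pi : ℂ) * Complex.I * (a : ℂ) / (k : ℂ))

/-- The factor `Z(s, θ)` from the functional equation. -/
def Zfun {k : ℕ} (θ : DirichletCharacter ℂ k) (s : ℂ) : ℂ :=
  if θ (-1) = 1 then
    tauSum θ * (Real.pi : ℂ) ^ (s - 1 / 2) * (k : ℂ) ^ (-s) *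
      Complex.Gamma ((1 - s) / 2) / Complex.Gamma (s / 2)
  else
    -Complex.I * tauSum θ * (Real.pi : ℂ) ^ (s - 1 / 2) * (k : ℂ) ^ (-s) *
      Complex.Gamma ((2 - s) / 2) / Complex.Gamma ((1 + s) / 2)

/-- The product character `χψ` modulo `D * p`, i.e. `n ↦ χ(n) ψ(n)`. -/
def chiPsi (D : ℕ) (χ : DirichletCharacter ℂ D) {p : ℕ} (ψ : DirichletCharacter ℂ p) :
    DirichletCharacter ℂ (D * p) :=
  DirichletCharacter.changeLevel (dvd_mul_right D p) χ *
    DirichletCharacter.changeLevel (dvd_mul_left p D) ψ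

/-- `Z̃(s, ψ) = Z(s, ψ) Z(s, χψ)`. -/
def Ztilde (D : ℕ) (χ : DirichletCharacter ℂ D) {p : ℕ} (ψ : DirichletCharacter ℂ p)
    (s : ℂ) : ℂ :=
  Zfun ψ s * Zfun (chiPsi D χ ψ) s

/-- `T = exp (𝓛 ^ 1.1)`. -/
def bigT (D : ℕ) : ℝ := Real.exp (bigL D ^ (1.1 : ℝ))

/-- `P₄ = P T⁻² t₀`. -/
def P4 (D : ℕ) : ℝ := bigP D * bigT D ^ (-2 : ℤ) * t0 D

/-- The smooth weight `g(x) = π^{-1/2} ∫_{-∞}^{𝓛^{15} log x} e^{-u²} du`. -/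
def gfun (D : ℕ) (x : ℝ) : ℝ :=
  Real.pi ^ (-(1 : ℝ) / 2) * ∫ u in Set.Iio (bigL D ^ 15 * Real.log x), Real.exp (-u ^ 2)

/-- `g*(y) = g(y)` for `y > 1/2`, and `0` otherwise. -/
def gstar (D : ℕ) (y : ℝ) : ℝ := if 1 / 2 < y then gfun D y else 0

/-- `K(s, ψ) = ∑_n ψ(n) n^{-s} g*(P₄ / n)`. -/
def Kfun (D : ℕ) {p : ℕ} (ψ : DirichletCharacter ℂ p) (s : ℂ) : ℂ :=
  ∑' n : ℕ, ψ (n : ZMod p) * (n : ℂ) ^ (-s) * ((gstar D (P4 D / n) : ℝ) : ℂ)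

/-- `N(1 - s, ψ̄) = ∑_n conj(ψ(n)) n^{s-1} g*(T² / n)`, as a function of `s`. -/
def Nfun (D : ℕ) {p : ℕ} (ψ : DirichletCharacter ℂ p) (s : ℂ) : ℂ :=
  ∑' n : ℕ,
    (starRingEnd ℂ) (ψ (n : ZMod p)) * (n : ℂ) ^ (s - 1) * ((gstar D (bigT D ^ 2 / n) : ℝ) : ℂ)

/-- `𝔞 = (6/π²) L'(1,χ)² ∏_{q ∣ D} q/(q+1)`. -/
def fraka (D : ℕ) (χ : DirichletCharacter ℂ D) : ℂ :=
  6 / (Real.pi : ℂ) ^ 2 * deriv (Lfun χ) 1 ^ 2 * ∏ q ∈ D.primeFactors, (q : ℂ) / ((q : ℂ) + 1)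

/-- Abel summation bound. -/
lemma abel_bound {E : Type*} [NormedAddCommGroup E] [NormedSpace ℝ E] (a : ℕ → E) (f : ℕ → ℝ)
    (M : ℕ) (B : ℝ)
    (hA : ∀ N, ‖∑ k ∈ Finset.Ioc M N, a k‖ ≤ B) (hf : ∀ k, M < k → f (k+1) ≤ f k)
    (hf0 : ∀ k, M < k → 0 ≤ f k) (N : ℕ) (hN : M ≤ N) :
    ‖∑ k ∈ Finset.Ioc M N, f k • a k‖ ≤ B * f (M+1) := by
  have key : ‖(∑ k ∈ Finset.Ioc M N, f k • a k) - f (N+1) • ∑ k ∈ Finset.Ioc M N, a k‖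
      ≤ B * (f (M+1) - f (N+1)) := by
    induction N, hN using Nat.le_induction with
    | base => simp
    | succ n hn ih =>
      have e : (∑ k ∈ Finset.Ioc M (n+1), f k • a k)
            - f (n+1+1) • ∑ k ∈ Finset.Ioc M (n+1), a k
          = ((∑ k ∈ Finset.Ioc M n, f k • a k) - f (n+1) • ∑ k ∈ Finset.Ioc M n, a k)
            + (f (n+1) - f (n+1+1)) • ∑ k ∈ Finset.Ioc M (n+1), a k := by
        rw [Finset.sum_Ioc_succ_top (by omega), Finset.sum_Ioc_succ_top (by omega)]
        simp only [smul_add, sub_smul]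
        abel
      rw [e]
      refine (norm_add_le _ _).trans ?_
      have h1 : 0 ≤ f (n+1) - f (n+1+1) := sub_nonneg.mpr (hf _ (by omega))
      have h2 : ‖(f (n+1) - f (n+1+1)) • ∑ k ∈ Finset.Ioc M (n+1), a k‖
          ≤ (f (n+1) - f (n+1+1)) * B := by
        rw [norm_smul, Real.norm_of_nonneg h1]
        exact mul_le_mul_of_nonneg_left (hA _) h1
      linarith
  have h3 : ‖f (N+1) • ∑ k ∈ Finset.Ioc M N, a k‖ ≤ f (N+1) * B := by
    rw [norm_smul, Real.norm_of_nonneg (hf0 _ (by omega))]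
    exact mul_le_mul_of_nonneg_left (hA _) (hf0 _ (by omega))
  have h4 := norm_add_le ((∑ k ∈ Finset.Ioc M N, f k • a k)
    - f (N+1) • ∑ k ∈ Finset.Ioc M N, a k) (f (N+1) • ∑ k ∈ Finset.Ioc M N, a k)
  rw [sub_add_cancel] at h4
  linarith

lemma char_range_bound {D : ℕ} [NeZero D] (χ : DirichletCharacter ℂ D) (hχ : χ ≠ 1) (N : ℕ) :
    ‖∑ k ∈ Finset.range N, χ (k : ZMod D)‖ ≤ D := by
  have h0 : ∑ k ∈ Finset.range D, χ (k : ZMod D) = 0 := by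
    rw [← MulChar.sum_eq_zero_of_ne_one hχ]
    refine Finset.sum_bij' (fun k _ => (k : ZMod D)) (fun a _ => a.val) ?_ ?_ ?_ ?_ ?_
    · simp
    · intro a _; simpa using ZMod.val_lt a
    · intro a ha; simpa using ZMod.val_cast_of_lt (Finset.mem_range.mp ha)
    · simp
    · simp
  induction N using Nat.strong_induction_on with
  | _ N ih =>
    by_cases h : N < D
    · calc _ ≤ ∑ k ∈ Finset.range N, ‖χ (k : ZMod D)‖ := norm_sum_le _ _
        _ ≤ ∑ k ∈ Finset.range N, 1 := Finset.sum_le_sum fun k _ => χ.norm_le_one _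
        _ ≤ D := by simpa using h.le
    · obtain ⟨m, rfl⟩ := Nat.exists_eq_add_of_le (not_lt.mp h)
      rw [Finset.sum_range_add, h0, zero_add]
      have := ih m (by have := NeZero.pos D; omega)
      simpa using this

lemma char_Ioc_bound {D : ℕ} [NeZero D] (χ : DirichletCharacter ℂ D) (hχ : χ ≠ 1) (M N : ℕ) :
    ‖∑ k ∈ Finset.Ioc M N, χ (k : ZMod D)‖ ≤ 2 * D := by
  by_cases h : M ≤ N
  · have e : ∑ k ∈ Finset.Ioc M N, χ (k : ZMod D)
        = ∑ k ∈ Finset.range (N+1), χ (k : ZMod D) - ∑ k ∈ Finset.range (M+1), χ (k : ZMod D) := by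
      rw [← Finset.sum_Ico_eq_sub _ (by omega)]
      apply Finset.sum_congr _ fun _ _ => rfl
      ext; simp
    rw [e]
    have := norm_sub_le (∑ k ∈ Finset.range (N+1), χ (k : ZMod D))
      (∑ k ∈ Finset.range (M+1), χ (k : ZMod D))
    linarith [char_range_bound χ hχ (N+1), char_range_bound χ hχ (M+1)]
  · rw [Finset.Ioc_eq_empty (by omega)]; simp

open Filter Topology in
lemma L_one_bound {D : ℕ} [NeZero D] (χ : DirichletCharacter ℂ D) (hχ : χ ≠ 1) (y : ℕ) :
    ‖χ.LFunction 1 - ∑ d ∈ Finset.Ioc 0 y, χ (d : ZMod D) / (d : ℂ)‖ ≤ 2 * D / (y + 1) := by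
  have step : ∀ s : ℝ, 1 < s →
      ‖χ.LFunction s - ∑ d ∈ Finset.Ioc 0 y, χ (d : ZMod D) / (d : ℂ) ^ (s : ℂ)‖
        ≤ 2 * D / (y + 1) := by
    intro s hs
    have hs' : 1 < (s : ℂ).re := by simpa
    have hsum := (χ.LSeriesSummable_of_one_lt_re hs').LSeriesHasSum
    rw [← χ.LFunction_eq_LSeries hs'] at hsum
    have ht := (HasSum.tendsto_sum_nat hsum).comp (tendsto_add_atTop_nat 1)
    have ht2 := (ht.sub_const (∑ d ∈ Finset.Ioc 0 y, χ (d : ZMod D) / (d : ℂ) ^ (s : ℂ))).norm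
    refine le_of_tendsto ht2 ?_
    filter_upwards [eventually_ge_atTop y] with N hN
    have e : ∑ i ∈ Finset.range (N+1), LSeries.term (fun n => χ (n : ZMod D)) s i
        - ∑ d ∈ Finset.Ioc 0 y, χ (d : ZMod D) / (d : ℂ) ^ (s : ℂ)
        = ∑ k ∈ Finset.Ioc y N, ((k : ℝ) ^ (-s)) • χ (k : ZMod D) := by
      rw [Finset.sum_range_succ', LSeries.term_zero, add_zero]
      have : ∑ i ∈ Finset.range N, LSeries.term (fun n => χ (n : ZMod D)) s (i+1)
          = ∑ d ∈ Finset.Ioc 0 N, χ (d : ZMod D) / (d : ℂ) ^ (s : ℂ) := by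
        rw [Finset.range_eq_Ico, Finset.sum_Ico_add' (fun i => LSeries.term (fun n => χ (n : ZMod D)) s i)]
        apply Finset.sum_congr
        · ext; simp; omega
        · intro i hi
          rw [LSeries.term_of_ne_zero (by simp at hi; omega)]
      rw [this, ← Finset.sum_Ioc_consecutive _ (Nat.zero_le y) hN, add_sub_cancel_left]
      refine Finset.sum_congr rfl fun k hk => ?_
      rw [Complex.real_smul, Complex.ofReal_cpow (by positivity), div_eq_mul_inv, mul_comm]
      push_cast
      rw [Complex.cpow_neg]
    simp only [Function.comp]
    rw [e]
    refine (abel_bound _ (fun k : ℕ => (k : ℝ) ^ (-s)) y (2*D) (fun N => char_Ioc_bound χ hχ y N)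
      ?_ (fun k _ => by positivity) N hN).trans ?_
    · intro k hk
      apply Real.rpow_le_rpow_of_nonpos
      · exact_mod_cast (by omega : 0 < k)
      · push_cast; linarith
      · linarith
    · rw [div_eq_mul_inv]
      apply mul_le_mul_of_nonneg_left _ (by positivity)
      rw [← Real.rpow_neg_one]
      push_cast
      apply Real.rpow_le_rpow_of_exponent_le
      · have : (0:ℝ) ≤ y := by positivity
        linarith
      · linarith
  have hc : ContinuousAt (fun s : ℝ => ‖χ.LFunction s
      - ∑ d ∈ Finset.Ioc 0 y, χ (d : ZMod D) / (d : ℂ) ^ (s : ℂ)‖) 1 := by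
    apply ContinuousAt.norm
    apply ContinuousAt.sub
    · exact (((DirichletCharacter.differentiable_LFunction hχ).continuous).comp
        Complex.continuous_ofReal).continuousAt
    · apply tendsto_finsetSum
      intro d hd
      have hd0 : (d : ℂ) ≠ 0 := by
        simp at hd ⊢; omega
      apply ContinuousAt.div continuousAt_const
      · exact ContinuousAt.const_cpow Complex.continuous_ofReal.continuousAt (Or.inl hd0)
      · simp [hd0]
  have := le_of_tendsto (hc.tendsto.mono_left (nhdsWithin_le_nhds (s := Set.Ioi 1)))
    (by filter_upwards [self_mem_nhdsWithin] with s hs using step s hs)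
  simpa using this

/-- The real part of `χ` as an arithmetic function. -/
def cR {D : ℕ} (χ : DirichletCharacter ℂ D) : ArithmeticFunction ℝ :=
  ⟨fun n => if n = 0 then 0 else (χ (n : ZMod D)).re, by simp⟩

/-- The real version of `ν`. -/
def nuR {D : ℕ} (χ : DirichletCharacter ℂ D) : ArithmeticFunction ℝ :=
  cR χ * (ArithmeticFunction.zeta : ArithmeticFunction ℝ)

lemma cR_apply {D : ℕ} (χ : DirichletCharacter ℂ D) {n : ℕ} (hn : n ≠ 0) :
    cR χ n = (χ (n : ZMod D)).re := by simp [cR, hn]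

lemma nuR_apply {D : ℕ} (χ : DirichletCharacter ℂ D) (n : ℕ) :
    nuR χ n = ∑ d ∈ n.divisors, cR χ d := by
  rw [nuR, ArithmeticFunction.coe_mul_zeta_apply]

lemma cR_mult {D : ℕ} (χ : DirichletCharacter ℂ D) (h : ∀ a : ZMod D, (χ a).im = 0) :
    (cR χ).IsMultiplicative := by
  rw [ArithmeticFunction.IsMultiplicative.iff_ne_zero]
  refine ⟨by simp [cR], fun {m n} hm hn _ => ?_⟩
  rw [cR_apply χ (mul_ne_zero hm hn), cR_apply χ hm, cR_apply χ hn]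
  simp [h]

lemma nuR_mult {D : ℕ} (χ : DirichletCharacter ℂ D) (h : ∀ a : ZMod D, (χ a).im = 0) :
    (nuR χ).IsMultiplicative :=
  (cR_mult χ h).mul ArithmeticFunction.isMultiplicative_zeta.natCast

lemma real_val {D : ℕ} (χ : DirichletCharacter ℂ D) (h : ∀ a : ZMod D, (χ a).im = 0)
    (a : ZMod D) : (χ a).re = 0 ∨ (χ a).re = 1 ∨ (χ a).re = -1 := by
  by_cases ha : IsUnit a
  · right
    have h1 := χ.unit_norm_eq_one ha.unit
    rw [ha.unit_spec] at h1
    have h2 : ((χ a).re : ℂ) = χ a := by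
      apply Complex.ext <;> simp [h]
    rw [← h2, Complex.norm_real, Real.norm_eq_abs] at h1
    exact eq_or_eq_neg_of_abs_eq h1
  · left; rw [χ.map_nonunit ha]; simp

lemma nuR_prime_pow {D : ℕ} (χ : DirichletCharacter ℂ D) (h : ∀ a : ZMod D, (χ a).im = 0)
    {p : ℕ} (hp : p.Prime) (k : ℕ) :
    nuR χ (p ^ k) = ∑ i ∈ Finset.range (k+1), (χ (p : ZMod D)).re ^ i := by
  rw [nuR_apply, Nat.sum_divisors_prime_pow hp]
  refine Finset.sum_congr rfl fun i _ => ?_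
  rw [cR_apply χ (pow_ne_zero _ hp.ne_zero)]
  have h2 : ((χ p).re : ℂ) = χ p := by
    apply Complex.ext <;> simp [h]
  push_cast
  rw [map_pow, ← h2, ← Complex.ofReal_pow, Complex.ofReal_re, Complex.ofReal_re]

lemma nuR_nonneg {D : ℕ} (χ : DirichletCharacter ℂ D) (h : ∀ a : ZMod D, (χ a).im = 0)
    (n : ℕ) : 0 ≤ nuR χ n := by
  rcases eq_or_ne n 0 with rfl | hn
  · simp
  · rw [(nuR_mult χ h).multiplicative_factorization _ hn]
    refine Finset.prod_nonneg fun p hp => ?_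
    beta_reduce
    rw [nuR_prime_pow χ h (Nat.prime_of_mem_primeFactors hp)]
    rcases real_val χ h p with e | e | e
    · rw [e]; exact Finset.sum_nonneg fun i _ => by positivity
    · rw [e]; exact Finset.sum_nonneg fun i _ => by positivity
    · rw [e, neg_one_geom_sum]; split_ifs <;> norm_num

lemma nuR_sq_prime_pow {D : ℕ} (χ : DirichletCharacter ℂ D) (h : ∀ a : ZMod D, (χ a).im = 0)
    {p : ℕ} (hp : p.Prime) (k : ℕ) :
    nuR χ (p ^ k) ^ 2 ≤ (nuR χ * nuR χ) (p ^ k) := by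
  rw [ArithmeticFunction.mul_apply,
    Nat.sum_divisorsAntidiagonal (fun a b => nuR χ a * nuR χ b), Nat.sum_divisors_prime_pow hp]
  have e1 : ∀ i ∈ Finset.range (k+1), nuR χ (p ^ i) * nuR χ (p ^ k / p ^ i)
      = nuR χ (p ^ i) * nuR χ (p ^ (k - i)) := by
    intro i hi
    rw [Nat.pow_div (by simp at hi; omega) hp.pos]
  rw [Finset.sum_congr rfl e1]
  rcases real_val χ h p with e | e | e
  · have hv : ∀ j, nuR χ (p ^ j) = 1 := by
      intro j; rw [nuR_prime_pow χ h hp, e]; simp [Finset.sum_range_succ']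
    simp [hv]
  · have hv : ∀ j : ℕ, nuR χ (p ^ j) = (j : ℝ) + 1 := by
      intro j; rw [nuR_prime_pow χ h hp, e]; simp
    simp only [hv]
    calc ((k : ℝ) + 1) ^ 2 = ∑ i ∈ Finset.range (k+1), ((k : ℝ) + 1) := by
          simp; ring
      _ ≤ _ := by
          refine Finset.sum_le_sum fun i hi => ?_
          obtain ⟨j, rfl⟩ := Nat.exists_eq_add_of_le (Nat.lt_succ_iff.mp (Finset.mem_range.mp hi))
          rw [Nat.add_sub_cancel_left]
          push_cast
          have : (0:ℝ) ≤ i * j := by positivity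
          nlinarith
  · have hv : ∀ j : ℕ, nuR χ (p ^ j) = if Even (j+1) then 0 else 1 := by
      intro j; rw [nuR_prime_pow χ h hp, e, neg_one_geom_sum]
    have h0 : nuR χ (p ^ k) ^ 2 = nuR χ (p ^ 0) * nuR χ (p ^ (k - 0)) := by
      rw [hv 0, Nat.sub_zero, hv k]
      by_cases hk : Even (k+1)
      · rw [if_pos hk]; simp
      · rw [if_neg hk]; simp
    rw [h0]
    exact Finset.single_le_sum (f := fun i => nuR χ (p ^ i) * nuR χ (p ^ (k - i)))
      (fun i _ => mul_nonneg (nuR_nonneg χ h _) (nuR_nonneg χ h _)) (by simp)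

lemma nuR_sq_le {D : ℕ} (χ : DirichletCharacter ℂ D) (h : ∀ a : ZMod D, (χ a).im = 0)
    (n : ℕ) : nuR χ n ^ 2 ≤ (nuR χ * nuR χ) n := by
  rcases eq_or_ne n 0 with rfl | hn
  · simp
  · have hm := nuR_mult χ h
    rw [(hm.mul hm).multiplicative_factorization _ hn, hm.multiplicative_factorization _ hn,
      Finsupp.prod, Finsupp.prod, ← Finset.prod_pow]
    refine Finset.prod_le_prod (fun p _ => sq_nonneg _) fun p hp => ?_
    exact nuR_sq_prime_pow χ h (Nat.prime_of_mem_primeFactors hp) _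

lemma conv_bound (f : ArithmeticFunction ℝ) (hf : ∀ n, 0 ≤ f n) (K M N : ℕ) (hK : M * M ≤ K) :
    ∑ n ∈ Finset.Ioc K N, (f * f) n / (n : ℝ) ≤
      2 * ((∑ a ∈ Finset.Ioc M N, f a / (a : ℝ)) * ∑ b ∈ Finset.Ioc 0 N, f b / (b : ℝ)) := by
  set F : ℕ × ℕ → ℝ := fun x => (f x.1 / x.1) * (f x.2 / x.2) with hF
  have hF0 : ∀ x, 0 ≤ F x := fun x => by
    have := hf x.1
    have := hf x.2
    simp only [hF]; positivity
  set S := Finset.Ioc 0 N ×ˢ Finset.Ioc 0 N with hS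
  have e1 : ∑ n ∈ Finset.Ioc K N, (f * f) n / (n : ℝ)
      = ∑ n ∈ Finset.Ioc K N, ∑ x ∈ S, if x.1 * x.2 = n then F x else 0 := by
    refine Finset.sum_congr rfl fun n hn => ?_
    simp only [Finset.mem_Ioc] at hn
    rw [ArithmeticFunction.mul_apply,
      Nat.divisorsAntidiagonal_eq_prod_filter_of_le (by omega) hn.2, Finset.sum_div,
      Finset.sum_filter]
    refine Finset.sum_congr rfl fun x hx => ?_
    split_ifs with hxn
    · rw [← hxn, hF]; push_cast; rw [div_mul_div_comm]
    · rfl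
  have e2 : ∀ g : ℕ → ℝ, ∑ a ∈ Finset.Ioc M N, g a
      = ∑ a ∈ Finset.Ioc 0 N, if M < a then g a else 0 := by
    intro g
    rw [← Finset.sum_filter]
    refine Finset.sum_congr ?_ fun _ _ => rfl
    ext; simp; omega
  have e3 : ∑ x ∈ S, (if M < x.1 then F x else 0)
      = (∑ a ∈ Finset.Ioc M N, f a / (a : ℝ)) * ∑ b ∈ Finset.Ioc 0 N, f b / (b : ℝ) := by
    rw [e2, Finset.sum_mul_sum, hS, Finset.sum_product]
    refine Finset.sum_congr rfl fun a _ => Finset.sum_congr rfl fun b _ => ?_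
    simp only [hF]; split_ifs <;> simp
  have e4 : ∑ x ∈ S, (if M < x.2 then F x else 0)
      = (∑ a ∈ Finset.Ioc M N, f a / (a : ℝ)) * ∑ b ∈ Finset.Ioc 0 N, f b / (b : ℝ) := by
    rw [e2, Finset.sum_mul_sum, hS, Finset.sum_product_right]
    refine Finset.sum_congr rfl fun a _ => Finset.sum_congr rfl fun b _ => ?_
    simp only [hF]; split_ifs <;> simp [mul_comm]
  rw [e1, Finset.sum_comm, two_mul]
  nth_rewrite 1 [← e3]
  rw [← e4, ← Finset.sum_add_distrib]
  refine Finset.sum_le_sum fun x _ => ?_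
  rw [Finset.sum_ite_eq]
  have := hF0 x
  by_cases hx : x.1 * x.2 ∈ Finset.Ioc K N
  · rw [if_pos hx]
    simp only [Finset.mem_Ioc] at hx
    by_cases h1 : M < x.1
    · rw [if_pos h1]; split_ifs <;> linarith
    · have h2 : M < x.2 := by
        by_contra h2
        have := Nat.mul_le_mul (not_lt.mp h1) (not_lt.mp h2)
        omega
      rw [if_pos h2, if_neg h1, zero_add]
  · rw [if_neg hx]; split_ifs <;> linarith

/-- Upper bound for the summatory function of `ν`. -/
lemma nuR_sum_bound {D : ℕ} [NeZero D] (χ : DirichletCharacter ℂ D) (hχ : χ ≠ 1)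
    (x : ℕ) (hx : D ^ 2 ≤ x) :
    ∑ n ∈ Finset.Ioc 0 x, nuR χ n ≤ x * ((χ.LFunction 1).re + 5 / Real.sqrt D) := by
  have hD : (0:ℝ) < D := by exact_mod_cast NeZero.pos D
  have hx0 : (0:ℝ) < x := by
    have : 0 < D ^ 2 := by have := NeZero.pos D; positivity
    exact_mod_cast (by omega : 0 < x)
  set y := Nat.sqrt (D * x) with hy
  have hyx : y ≤ x := by
    rw [hy]
    calc Nat.sqrt (D * x) ≤ Nat.sqrt (x * x) := Nat.sqrt_le_sqrt (by
          apply Nat.mul_le_mul_right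
          nlinarith [NeZero.pos D])
      _ = x := Nat.sqrt_eq x
  have hy1 : (y:ℝ) ≤ Real.sqrt (D * x) := by
    apply Real.le_sqrt_of_sq_le
    rw [sq]; exact_mod_cast Nat.sqrt_le (D * x)
  have hy2 : Real.sqrt (D * x) ≤ y + 1 := by
    rw [Real.sqrt_le_left (by positivity), sq]
    exact_mod_cast (Nat.lt_succ_sqrt (D * x)).le
  have e0 : ∑ n ∈ Finset.Ioc 0 x, nuR χ n = ∑ d ∈ Finset.Ioc 0 x, cR χ d * ((x / d : ℕ) : ℝ) :=
    ArithmeticFunction.sum_Ioc_mul_zeta_eq_sum (cR χ) x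
  rw [e0, ← Finset.sum_Ioc_consecutive _ (Nat.zero_le y) hyx]
  have hA1 : ∑ d ∈ Finset.Ioc 0 y, cR χ d * ((x / d : ℕ) : ℝ)
      ≤ ∑ d ∈ Finset.Ioc 0 y, (x * (cR χ d / d) + 1) := by
    refine Finset.sum_le_sum fun d hd => ?_
    simp only [Finset.mem_Ioc] at hd
    have hc : |cR χ d| ≤ 1 := by
      rw [cR_apply χ (by omega)]
      exact (Complex.abs_re_le_norm _).trans (χ.norm_le_one _)
    have h1 : ((x / d : ℕ) : ℝ) ≤ (x : ℝ) / d := Nat.cast_div_le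
    have hd0 : (0:ℝ) < d := by exact_mod_cast hd.1
    have h2 : (x : ℝ) / d ≤ ((x / d : ℕ) : ℝ) + 1 := by
      rw [div_le_iff₀ hd0]
      have := (Nat.lt_mul_div_succ x hd.1).le
      have h3 : (x:ℝ) ≤ d * ((x / d : ℕ) + 1) := by exact_mod_cast this
      linarith
    have h4 : x * (cR χ d / d) = cR χ d * ((x:ℝ) / d) := by ring
    rw [h4]
    obtain ⟨h5, h6⟩ := abs_le.mp hc
    nlinarith
  have hA2 : ∑ d ∈ Finset.Ioc 0 y, (x * (cR χ d / d) + 1)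
      = x * (∑ d ∈ Finset.Ioc 0 y, cR χ d / d) + y := by
    rw [Finset.sum_add_distrib, ← Finset.mul_sum]; simp
  have hA3 : ∑ d ∈ Finset.Ioc 0 y, cR χ d / d ≤ (χ.LFunction 1).re + 2 * D / (y + 1) := by
    have h1 := (Complex.abs_re_le_norm _).trans (L_one_bound χ hχ y)
    have h2 : (∑ d ∈ Finset.Ioc 0 y, χ (d : ZMod D) / (d : ℂ)).re
        = ∑ d ∈ Finset.Ioc 0 y, cR χ d / d := by
      rw [Complex.re_sum]
      refine Finset.sum_congr rfl fun d hd => ?_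
      rw [cR_apply χ (by simp at hd; omega), Complex.div_natCast_re]
    rw [Complex.sub_re, h2] at h1
    linarith [(abs_le.mp h1).1]
  have hB : ∑ d ∈ Finset.Ioc y x, cR χ d * ((x / d : ℕ) : ℝ) ≤ 2 * D * (x / (y + 1)) := by
    have h1 := abel_bound (fun k : ℕ => χ (k : ZMod D)) (fun d => ((x / d : ℕ) : ℝ)) y (2 * D)
      (fun N => char_Ioc_bound χ hχ y N)
      (fun k hk => by
        exact_mod_cast Nat.div_le_div_left (Nat.le_succ k) (by omega)) (fun k _ => by positivity)
      x hyx
    have h2 := (le_abs_self _).trans ((Complex.abs_re_le_norm _).trans h1)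
    rw [Complex.re_sum] at h2
    have h3 : ∑ d ∈ Finset.Ioc y x, cR χ d * ((x / d : ℕ) : ℝ)
        = ∑ d ∈ Finset.Ioc y x, (((x / d : ℕ) : ℝ) • χ (d : ZMod D)).re := by
      refine Finset.sum_congr rfl fun d hd => ?_
      rw [cR_apply χ (by simp at hd; omega), Complex.smul_re, smul_eq_mul, mul_comm]
    rw [h3]
    refine h2.trans (mul_le_mul_of_nonneg_left ?_ (by positivity))
    have : ((x / (y+1) : ℕ) : ℝ) ≤ (x : ℝ) / ((y + 1 : ℕ) : ℝ) := Nat.cast_div_le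
    simpa using this
  have hq : (D:ℝ) * x / (y + 1) ≤ Real.sqrt (D * x) := by
    rw [div_le_iff₀ (by positivity)]
    have h1 := Real.mul_self_sqrt (show (0:ℝ) ≤ D * x by positivity)
    have h2 := Real.sqrt_nonneg ((D:ℝ) * x)
    nlinarith
  have hr : Real.sqrt (D * x) ≤ x / Real.sqrt D := by
    rw [le_div_iff₀ (Real.sqrt_pos.mpr hD), Real.sqrt_mul hD.le]
    have h1 := Real.mul_self_sqrt hD.le
    have h2 : (D:ℝ) ≤ Real.sqrt x := by
      apply Real.le_sqrt_of_sq_le; exact_mod_cast hx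
    have h3 := Real.mul_self_sqrt hx0.le
    have h4 := Real.sqrt_nonneg (x:ℝ)
    calc Real.sqrt D * Real.sqrt x * Real.sqrt D = D * Real.sqrt x := by
          rw [mul_right_comm, h1]
      _ ≤ Real.sqrt x * Real.sqrt x := mul_le_mul_of_nonneg_right h2 h4
      _ = x := h3
  have hA4 := mul_le_mul_of_nonneg_left hA3 hx0.le
  have e5 : (x:ℝ) * ((χ.LFunction 1).re + 2 * D / (y + 1))
      = x * (χ.LFunction 1).re + 2 * (D * x / (y + 1)) := by ring
  have e6 : 2 * (D:ℝ) * (x / (y + 1)) = 2 * (D * x / (y + 1)) := by ring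
  have e7 : (x:ℝ) * ((χ.LFunction 1).re + 5 / Real.sqrt D)
      = x * (χ.LFunction 1).re + 5 * (x / Real.sqrt D) := by ring
  rw [e7]
  rw [e5] at hA4
  rw [e6] at hB
  linarith

lemma dyadic_bound (f : ℕ → ℝ) (hf : ∀ n, 0 ≤ f n) (M : ℕ) (hM : 0 < M) (δ : ℝ)
    (h : ∀ x, M ≤ x → ∑ n ∈ Finset.Ioc 0 x, f n ≤ x * δ) (k : ℕ) :
    ∑ n ∈ Finset.Ioc M (2 ^ k * M), f n / (n : ℝ) ≤ k * (2 * δ) := by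
  induction k with
  | zero => simp
  | succ k ih =>
    have h2 : 0 < 2 ^ k * M := by positivity
    have hle : M ≤ 2 ^ k * M := Nat.le_mul_of_pos_left _ (by positivity)
    have e : 2 ^ (k+1) * M = 2 * (2 ^ k * M) := by ring
    rw [e, ← Finset.sum_Ioc_consecutive _ hle (by omega : 2 ^ k * M ≤ 2 * (2 ^ k * M))]
    set Q := 2 ^ k * M with hQ
    have hQ0 : (0:ℝ) < Q := by exact_mod_cast h2
    have h3 : ∑ n ∈ Finset.Ioc Q (2 * Q), f n / (n : ℝ) ≤ 2 * δ := by
      calc ∑ n ∈ Finset.Ioc Q (2 * Q), f n / (n : ℝ)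
          ≤ ∑ n ∈ Finset.Ioc Q (2 * Q), f n / (Q : ℝ) := by
            refine Finset.sum_le_sum fun n hn => ?_
            apply div_le_div_of_nonneg_left (hf n) hQ0
            exact_mod_cast (Finset.mem_Ioc.mp hn).1.le
        _ = (∑ n ∈ Finset.Ioc Q (2 * Q), f n) / Q := by rw [Finset.sum_div]
        _ ≤ (∑ n ∈ Finset.Ioc 0 (2 * Q), f n) / Q := by
            apply div_le_div_of_nonneg_right _ hQ0.le
            exact Finset.sum_le_sum_of_subset_of_nonneg
              (Finset.Ioc_subset_Ioc_left (Nat.zero_le _)) fun n _ _ => hf n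
        _ ≤ 2 * δ := by
            rw [div_le_iff₀ hQ0]
            have := h (2 * Q) (by omega)
            push_cast at this
            linarith
    push_cast
    linarith

lemma nuR_harm {D : ℕ} (χ : DirichletCharacter ℂ D) (N : ℕ) (hN : 0 < N) :
    ∑ n ∈ Finset.Ioc 0 N, nuR χ n / (n : ℝ) ≤ (1 + Real.log N) ^ 2 := by
  have hH : ∑ n ∈ Finset.Ioc 0 N, (1 : ℝ) / n ≤ 1 + Real.log N := by
    have := harmonic_le_one_add_log N
    rw [harmonic_eq_sum_Icc] at this
    push_cast at this
    simpa [← Finset.Icc_succ_left_eq_Ioc] using this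
  have hc : ∀ d, cR χ d ≤ 1 := by
    intro d
    rcases eq_or_ne d 0 with rfl | hd
    · simp
    · rw [cR_apply χ hd]
      exact (le_abs_self _).trans ((Complex.abs_re_le_norm _).trans (χ.norm_le_one _))
  have h1 : ∑ n ∈ Finset.Ioc 0 N, nuR χ n / (n : ℝ)
      ≤ ∑ x ∈ Finset.Ioc 0 N ×ˢ Finset.Ioc 0 N, (1 / (x.1 : ℝ)) * (1 / (x.2 : ℝ)) := by
    calc ∑ n ∈ Finset.Ioc 0 N, nuR χ n / (n : ℝ)
        ≤ ∑ n ∈ Finset.Ioc 0 N, ∑ x ∈ Finset.Ioc 0 N ×ˢ Finset.Ioc 0 N,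
            if x.1 * x.2 = n then (1 / (x.1 : ℝ)) * (1 / (x.2 : ℝ)) else 0 := by
          refine Finset.sum_le_sum fun n hn => ?_
          simp only [Finset.mem_Ioc] at hn
          rw [nuR, ArithmeticFunction.mul_apply,
            Nat.divisorsAntidiagonal_eq_prod_filter_of_le (by omega) hn.2, Finset.sum_div,
            Finset.sum_filter]
          refine Finset.sum_le_sum fun x hx => ?_
          split_ifs with hxn
          · have hx2 : x.2 ≠ 0 := by rintro h; simp [h] at hxn; omega
            rw [← hxn]
            simp only [ArithmeticFunction.natCoe_apply, ArithmeticFunction.zeta_apply, hx2,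
              if_false]
            push_cast
            rw [div_mul_div_comm, mul_one, mul_one]
            exact div_le_div_of_nonneg_right (hc _) (by positivity)
          · rfl
      _ ≤ _ := by
          rw [Finset.sum_comm]
          refine Finset.sum_le_sum fun x _ => ?_
          rw [Finset.sum_ite_eq]
          split_ifs
          · rfl
          · positivity
  refine h1.trans ?_
  rw [Finset.sum_product]
  dsimp only
  rw [← Finset.sum_mul_sum, sq]
  have h0 : 0 ≤ ∑ n ∈ Finset.Ioc 0 N, (1 : ℝ) / n := Finset.sum_nonneg fun _ _ => by positivity
  exact mul_le_mul hH hH h0 (h0.trans hH)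

open Filter in
lemma large_D : ∃ D₀ : ℕ, ∀ D : ℕ, D₀ ≤ D → 1 ≤ bigL D ∧
    5 / Real.sqrt D ≤ bigL D ^ (-2022 : ℤ) := by
  have h1 := (Real.isLittleO_pow_log_id_atTop (n := 4044)).bound (show (0:ℝ) < 1/25 by norm_num)
  have h2 := tendsto_natCast_atTop_atTop (R := ℝ) |>.eventually h1
  have h3 := (Real.tendsto_log_atTop.comp (tendsto_natCast_atTop_atTop (R := ℝ))).eventually_ge_atTop 1
  have h4 := (h2.and h3).and (eventually_gt_atTop 0)
  obtain ⟨D₀, hD₀⟩ := eventually_atTop.mp h4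
  refine ⟨D₀, fun D hD => ?_⟩
  obtain ⟨⟨ha, hb⟩, hc⟩ := hD₀ D hD
  have hL : 1 ≤ bigL D := hb
  have hc' : (0:ℝ) < D := by exact_mod_cast hc
  refine ⟨hL, ?_⟩
  have hL0 : 0 < bigL D := by linarith
  have ha' : bigL D ^ 4044 ≤ 1/25 * (D:ℝ) := by
    have h5 : ‖Real.log (D:ℝ) ^ 4044‖ = bigL D ^ 4044 := Real.norm_of_nonneg (pow_nonneg hL0.le _)
    have h6 : ‖id (D:ℝ)‖ = D := Real.norm_of_nonneg hc'.le
    rwa [h5, h6] at ha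
  have e : bigL D ^ (-2022 : ℤ) = 1 / bigL D ^ 2022 := by
    rw [zpow_neg, one_div]; norm_cast
  rw [e, div_le_div_iff₀ (Real.sqrt_pos.mpr hc') (pow_pos hL0 _), one_mul]
  apply Real.le_sqrt_of_sq_le
  have : (5 * bigL D ^ 2022) ^ 2 = 25 * bigL D ^ 4044 := by
    rw [mul_pow, ← pow_mul]; norm_num
  rw [this]; linarith

/-- Under (A), `∑_{D⁴ < n ≤ P²} ν(n)²/n ≤ C 𝓛^{-2011}`. -/
theorem statement2 :
    ∃ C : ℝ, 0 < C ∧ ∃ D₀ : ℕ, ∀ D : ℕ, D₀ ≤ D → ∀ χ : DirichletCharacter ℂ D,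
      IsRealChar χ → χ.IsPrimitive → AssumptionA D χ →
        (∑ n ∈ Finset.Ioc (D ^ 4) ⌊bigP D ^ 2⌋₊, (nuF D χ n).re ^ 2 / (n : ℝ)) ≤
          C * bigL D ^ (-2011 : ℤ) := by
  obtain ⟨D₀, hD₀⟩ := large_D
  refine ⟨1160, by norm_num, D₀ + 2, fun D hD χ hreal hprim hA => ?_⟩
  obtain ⟨hL, hsq⟩ := hD₀ D (by omega)
  haveI : NeZero D := ⟨by omega⟩
  have hχ : χ ≠ 1 := by
    rintro rfl
    have h1 : (1 : DirichletCharacter ℂ D).conductor = D := hprim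
    rw [DirichletCharacter.conductor_one] at h1
    omega
  have hL0 : 0 < bigL D := by linarith
  set l := bigL D with hl
  have hre : (χ.LFunction 1).re < l ^ (-2022 : ℤ) := by
    have h1 : (Lfun χ 1).re < l ^ (-2022 : ℤ) := hA
    rwa [Lfun, dif_neg (by omega)] at h1
  set ε := l ^ (-2022 : ℤ) with hε
  have hε0 : 0 < ε := zpow_pos hL0 _
  have hnn := nuR_nonneg χ hreal
  have hM : 0 < D ^ 2 := pow_pos (by omega) 2
  set k := ⌈4 * l ^ 9⌉₊ with hk
  have hl9 : 1 ≤ l ^ 9 := one_le_pow₀ hL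
  have hk1 : (k:ℝ) ≤ 5 * l ^ 9 := by
    have := (Nat.ceil_lt_add_one (show 0 ≤ 4 * l ^ 9 by positivity)).le
    linarith
  have hk2 : 4 * l ^ 9 ≤ k := Nat.le_ceil _
  set N := 2 ^ k * D ^ 2 with hN
  have hPN : ⌊bigP D ^ 2⌋₊ ≤ N := by
    have h1 : bigP D ^ 2 ≤ 2 ^ k := by
      rw [bigP, ← Real.exp_nat_mul, ← Real.exp_log (show (0:ℝ) < 2 by norm_num),
        ← Real.exp_nat_mul, Real.exp_le_exp]
      have h2 := Real.log_two_gt_d9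
      push_cast
      have h3 : (k:ℝ) * 0.5 ≤ k * Real.log 2 :=
        mul_le_mul_of_nonneg_left (by linarith) (by positivity)
      rw [← hl]
      linarith
    have h2 : ⌊bigP D ^ 2⌋₊ ≤ 2 ^ k := by
      apply Nat.floor_le_of_le
      exact_mod_cast h1
    exact h2.trans (Nat.le_mul_of_pos_right _ hM)
  have hsum : ∀ x, D ^ 2 ≤ x → ∑ n ∈ Finset.Ioc 0 x, nuR χ n ≤ x * (2 * ε) := by
    intro x hx
    refine (nuR_sum_bound χ hχ x hx).trans (mul_le_mul_of_nonneg_left ?_ (by positivity))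
    linarith
  have hA1 : ∑ n ∈ Finset.Ioc (D ^ 2) N, nuR χ n / (n : ℝ) ≤ 20 * (l ^ 9 * ε) := by
    refine (dyadic_bound (nuR χ) hnn (D ^ 2) hM (2 * ε) hsum k).trans ?_
    nlinarith
  have hle1 : l ^ 9 * ε ≤ 1 := by
    have : l ^ 9 * ε = l ^ (-2013 : ℤ) := by
      rw [hε, ← zpow_natCast, ← zpow_add₀ hL0.ne']; norm_num
    rw [this]
    exact zpow_le_one_of_nonpos₀ hL (by norm_num)
  have hB1 : ∑ n ∈ Finset.Ioc 0 N, nuR χ n / (n : ℝ) ≤ 29 * l ^ 2 := by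
    rw [← Finset.sum_Ioc_consecutive _ (Nat.zero_le (D ^ 2))
      (Nat.le_mul_of_pos_left _ (by positivity) : D ^ 2 ≤ N)]
    have h1 := nuR_harm χ (D ^ 2) hM
    have h2 : Real.log ((D ^ 2 : ℕ) : ℝ) = 2 * l := by
      push_cast; rw [Real.log_pow]; rfl
    rw [h2] at h1
    nlinarith
  have hA0 : 0 ≤ ∑ n ∈ Finset.Ioc (D ^ 2) N, nuR χ n / (n : ℝ) :=
    Finset.sum_nonneg fun n _ => div_nonneg (hnn n) (by positivity)
  have hterm : ∀ n ∈ Finset.Ioc (D ^ 4) N, (nuF D χ n).re = nuR χ n := by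
    intro n hn
    rw [nuF, Complex.re_sum, nuR_apply]
    refine Finset.sum_congr rfl fun d hd => ?_
    rw [cR_apply χ (Nat.pos_of_mem_divisors hd).ne']
  calc (∑ n ∈ Finset.Ioc (D ^ 4) ⌊bigP D ^ 2⌋₊, (nuF D χ n).re ^ 2 / (n : ℝ))
      ≤ ∑ n ∈ Finset.Ioc (D ^ 4) N, (nuF D χ n).re ^ 2 / (n : ℝ) :=
        Finset.sum_le_sum_of_subset_of_nonneg (Finset.Ioc_subset_Ioc_right hPN)
          fun n _ _ => by positivity
    _ ≤ ∑ n ∈ Finset.Ioc (D ^ 4) N, (nuR χ * nuR χ) n / (n : ℝ) := by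
        refine Finset.sum_le_sum fun n hn => ?_
        rw [hterm n hn]
        exact div_le_div_of_nonneg_right (nuR_sq_le χ hreal n) (by positivity)
    _ ≤ 2 * ((∑ a ∈ Finset.Ioc (D ^ 2) N, nuR χ a / (a : ℝ)) *
          ∑ b ∈ Finset.Ioc 0 N, nuR χ b / (b : ℝ)) :=
        conv_bound (nuR χ) hnn (D ^ 4) (D ^ 2) N (by rw [← pow_add])
    _ ≤ 2 * ((20 * (l ^ 9 * ε)) * (29 * l ^ 2)) := by
        refine mul_le_mul_of_nonneg_left (mul_le_mul hA1 hB1 ?_ (by positivity)) (by norm_num)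
        exact Finset.sum_nonneg fun n _ => div_nonneg (hnn n) (by positivity)
    _ = 1160 * (l ^ 11 * ε) := by ring
    _ = 1160 * l ^ (-2011 : ℤ) := by
        have : l ^ 11 * ε = l ^ (-2011 : ℤ) := by
          rw [hε, ← zpow_natCast, ← zpow_add₀ hL0.ne']; norm_num
        rw [this]

end
end

section
/- There is a positive absolute constant C such that the following holds. If Assumption (A) holds, then Σ_{D⁴ < n ≤ D⁸} ν(n)²·τ₂(n)²/n ≤ C·𝓛^{-2007}, where τ₂(n) denotes the number of divisors of n. -/
open scoped Classical

noncomputable section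

namespace Aux3
open Finset

/-- number of divisors, as a real -/
noncomputable def tau (n : ℕ) : ℝ := (n.divisors.card : ℝ)

lemma tau_nonneg (n : ℕ) : 0 ≤ tau n := Nat.cast_nonneg _

lemma one_le_tau {n : ℕ} (hn : n ≠ 0) : 1 ≤ tau n := by
  have : 0 < n.divisors.card := Finset.card_pos.mpr ⟨1, by simp [hn]⟩
  unfold tau
  exact_mod_cast this

lemma tau_mul_le (a b : ℕ) : tau (a * b) ≤ tau a * tau b := by
  unfold tau
  rw [Nat.divisors_mul]
  exact_mod_cast Finset.card_mul_le

lemma fiber_le {ι : Type*} (P : Finset ι) (g : ι → ℕ) (F : ι → ℝ) (hF : ∀ x ∈ P, 0 ≤ F x)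
    (A : Finset ℕ) :
    ∑ n ∈ A, ∑ x ∈ P with g x = n, F x ≤ ∑ x ∈ P, F x := by
  classical
  have : ∑ n ∈ A, ∑ x ∈ P with g x = n, F x = ∑ x ∈ P with g x ∈ A, F x := by
    rw [← Finset.sum_fiberwise_of_maps_to (s := P.filter (fun x => g x ∈ A)) (t := A) (g := g)
      (by intro x hx; exact (Finset.mem_filter.mp hx).2)]
    refine Finset.sum_congr rfl fun n hn => ?_
    rw [Finset.filter_filter]
    refine Finset.sum_congr ?_ fun _ _ => rfl
    ext x; simp only [Finset.mem_filter]
    constructor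
    · rintro ⟨h1, h2⟩; exact ⟨h1, by rw [h2]; exact hn, h2⟩
    · rintro ⟨h1, _, h2⟩; exact ⟨h1, h2⟩
  rw [this]
  exact Finset.sum_le_sum_of_subset_of_nonneg (Finset.filter_subset _ _) (fun i hi _ => hF i hi)

lemma conv_le (N : ℕ) (g h : ℕ → ℝ) (hg : ∀ n, 0 ≤ g n) (hh : ∀ n, 0 ≤ h n) :
    ∑ n ∈ Icc 1 N, ∑ x ∈ n.divisorsAntidiagonal, g x.1 * h x.2 ≤
      (∑ n ∈ Icc 1 N, g n) * (∑ n ∈ Icc 1 N, h n) := by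
  rw [Finset.sum_mul_sum, ← Finset.sum_product']
  refine le_trans ?_ (fiber_le (Icc 1 N ×ˢ Icc 1 N) (fun x => x.1 * x.2)
    (fun x => g x.1 * h x.2) (fun x _ => mul_nonneg (hg _) (hh _)) (Icc 1 N))
  refine Finset.sum_le_sum fun n hn => ?_
  refine Finset.sum_le_sum_of_subset_of_nonneg ?_ (fun x _ _ => mul_nonneg (hg _) (hh _))
  intro x hx
  rw [Nat.mem_divisorsAntidiagonal] at hx
  rw [Finset.mem_Icc] at hn
  obtain ⟨hx, h0⟩ := hx
  have h1 : x.1 ≠ 0 := by rintro h; simp [h] at hx; omega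
  have h2 : x.2 ≠ 0 := by rintro h; simp [h] at hx; omega
  have h3 : x.1 ≤ n := Nat.le_of_dvd (by omega) ⟨_, hx.symm⟩
  have h4 : x.2 ≤ n := Nat.le_of_dvd (by omega) ⟨_, by rw [mul_comm]; exact hx.symm⟩
  simp only [Finset.mem_filter, Finset.mem_product, Finset.mem_Icc]
  exact ⟨⟨⟨by omega, by omega⟩, by omega, by omega⟩, hx⟩

lemma sum_tau_mul_le (N : ℕ) (g : ℕ → ℝ) (hg : ∀ n, 0 ≤ g n)
    (hs : ∀ a b, g (a * b) ≤ g a * g b) :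
    ∑ n ∈ Icc 1 N, tau n * g n ≤ (∑ n ∈ Icc 1 N, g n) ^ 2 := by
  rw [sq]
  refine le_trans ?_ (conv_le N g g hg hg)
  refine Finset.sum_le_sum fun n hn => ?_
  have : tau n = ∑ x ∈ n.divisorsAntidiagonal, (1 : ℝ) := by
    rw [Finset.sum_const, ← Nat.map_div_right_divisors]; simp [tau]
  rw [this, Finset.sum_mul]
  refine Finset.sum_le_sum fun x hx => ?_
  rw [Nat.mem_divisorsAntidiagonal] at hx
  rw [one_mul, ← hx.1]
  exact hs _ _

lemma sum_tau_pow_le (N : ℕ) (w : ℕ → ℝ) (hw : ∀ n, 0 ≤ w n)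
    (hs : ∀ a b, w (a * b) = w a * w b) (j : ℕ) :
    ∑ n ∈ Icc 1 N, tau n ^ j * w n ≤ (∑ n ∈ Icc 1 N, w n) ^ (2 ^ j) := by
  induction j with
  | zero => simp
  | succ j ih =>
    have h0 : ∀ n, 0 ≤ tau n ^ j * w n := fun n => mul_nonneg (pow_nonneg (tau_nonneg n) _) (hw n)
    have := sum_tau_mul_le N (fun n => tau n ^ j * w n) h0 (by
      intro a b
      have h1 : tau (a * b) ^ j ≤ (tau a * tau b) ^ j :=
        pow_le_pow_left₀ (tau_nonneg _) (tau_mul_le a b) j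
      calc tau (a * b) ^ j * w (a * b) ≤ (tau a * tau b) ^ j * w (a * b) :=
            mul_le_mul_of_nonneg_right h1 (hw _)
        _ = _ := by rw [hs, mul_pow]; ring)
    calc ∑ n ∈ Icc 1 N, tau n ^ (j + 1) * w n = ∑ n ∈ Icc 1 N, tau n * (tau n ^ j * w n) :=
          Finset.sum_congr rfl fun n _ => by ring
      _ ≤ _ := this
      _ ≤ ((∑ n ∈ Icc 1 N, w n) ^ (2 ^ j)) ^ 2 :=
          pow_le_pow_left₀ (Finset.sum_nonneg fun n _ => h0 n) ih 2
      _ = _ := by rw [← pow_mul, pow_succ]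

/-- A completely multiplicative function with values in {-1,0,1}. -/
structure RC (X : ℕ → ℝ) : Prop where
  one : X 1 = 1
  mul : ∀ a b, X (a * b) = X a * X b
  val : ∀ n, X n = 0 ∨ X n = 1 ∨ X n = -1

/-- divisor sum -/
noncomputable def v (X : ℕ → ℝ) (n : ℕ) : ℝ := ∑ d ∈ n.divisors, X d

/-- X as arithmetic function -/
noncomputable def XA (X : ℕ → ℝ) : ArithmeticFunction ℝ := ⟨fun n => if n = 0 then 0 else X n, by simp⟩

lemma v_eq (X : ℕ → ℝ) (n : ℕ) : v X n = ((ArithmeticFunction.zeta : ArithmeticFunction ℝ) * XA X) n := by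
  rw [ArithmeticFunction.coe_zeta_mul_apply]
  refine Finset.sum_congr rfl fun d hd => ?_
  have : d ≠ 0 := by rintro rfl; simp at hd
  simp [XA, this]

variable {X : ℕ → ℝ}

lemma v_mul (hX : RC X) {a b : ℕ} (h : a.Coprime b) : v X (a * b) = v X a * v X b := by
  have h1 : (XA X).IsMultiplicative := by
    refine ⟨by simp [XA, hX.one], ?_⟩
    intro m n _
    by_cases hm : m = 0
    · simp [XA, hm]
    by_cases hn : n = 0
    · simp [XA, hn]
    simp [XA, hm, hn, hX.mul]
  have h2 := (ArithmeticFunction.isMultiplicative_zeta.natCast (R := ℝ)).mul h1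
  rw [v_eq, v_eq, v_eq]
  exact h2.2 h

lemma X_pow (hX : RC X) (p k : ℕ) : X (p ^ k) = X p ^ k := by
  induction k with
  | zero => simp [hX.one]
  | succ k ih => rw [pow_succ, hX.mul, ih, pow_succ]

lemma v_pp (hX : RC X) {p : ℕ} (hp : p.Prime) (k : ℕ) :
    v X (p ^ k) = ∑ i ∈ range (k + 1), X p ^ i := by
  unfold v
  rw [Nat.sum_divisors_prime_pow hp]
  exact Finset.sum_congr rfl fun i _ => X_pow hX p i

lemma sum_neg_one (k : ℕ) : (∑ i ∈ range (k + 1), (-1 : ℝ) ^ i) = if Even k then 1 else 0 := by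
  induction k with
  | zero => simp
  | succ k ih =>
    rw [Finset.sum_range_succ, ih]
    by_cases h : Even k
    · simp [h, Nat.even_add_one, pow_succ]
    · have h' := Nat.not_even_iff_odd.mp h
      simp [Nat.even_add_one, h, pow_succ, h'.neg_one_pow]

lemma v_pp_nonneg (hX : RC X) {p : ℕ} (hp : p.Prime) (k : ℕ) : 0 ≤ v X (p ^ k) := by
  rw [v_pp hX hp]
  rcases hX.val p with h | h | h
  · rw [h]; exact Finset.sum_nonneg fun i _ => by positivity
  · rw [h]; exact Finset.sum_nonneg fun i _ => by positivity
  · rw [h, sum_neg_one]; split_ifs <;> norm_num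

lemma v_nonneg (hX : RC X) (n : ℕ) : 0 ≤ v X n := by
  induction n using Nat.recOnPosPrimePosCoprime with
  | prime_pow p k hp hk => exact v_pp_nonneg hX hp k
  | zero => simp [v]
  | one => simp [v, hX.one]
  | coprime a b ha hb hab iha ihb => rw [v_mul hX hab]; exact mul_nonneg iha ihb

lemma v_le_tau (hX : RC X) (n : ℕ) : v X n ≤ tau n := by
  unfold v tau
  calc _ ≤ ∑ d ∈ n.divisors, (1 : ℝ) := Finset.sum_le_sum fun d _ => by
        rcases hX.val d with h | h | h <;> rw [h] <;> norm_num
    _ = _ := by simp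

lemma v_pp_add (hX : RC X) {p : ℕ} (hp : p.Prime) (j k : ℕ) :
    v X (p ^ (j + 2 * k)) ≤ (2 * k + 1) * v X (p ^ j) := by
  rw [v_pp hX hp, v_pp hX hp]
  have hk : (0 : ℝ) ≤ k := Nat.cast_nonneg k
  have hj : (0 : ℝ) ≤ j := Nat.cast_nonneg j
  rcases hX.val p with h | h | h
  · rw [h, Finset.sum_range_succ', Finset.sum_range_succ']; simp
  · rw [h]; simp; nlinarith
  · rw [h, sum_neg_one, sum_neg_one]
    have : Even (j + 2 * k) ↔ Even j := by simp [Nat.even_add]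
    simp only [this]
    split_ifs <;> linarith

lemma v_mul_pp (hX : RC X) {p : ℕ} (hp : p.Prime) (n k : ℕ) (hn : n ≠ 0) :
    v X (n * p ^ (2 * k)) ≤ (2 * k + 1) * v X n := by
  obtain ⟨j, m, hm, rfl⟩ := Nat.exists_eq_pow_mul_and_not_dvd hn p hp.ne_one
  have hc : ∀ i, (p ^ i).Coprime m := fun i =>
    Nat.Coprime.pow_left i ((Nat.Prime.coprime_iff_not_dvd hp).mpr hm)
  have e : p ^ j * m * p ^ (2 * k) = p ^ (j + 2 * k) * m := by rw [pow_add]; ring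
  rw [e, v_mul hX (hc _), v_mul hX (hc _), ← mul_assoc]
  exact mul_le_mul_of_nonneg_right (v_pp_add hX hp j k) (v_nonneg hX m)

lemma v_mul_sq (hX : RC X) (m : ℕ) : m ≠ 0 → ∀ n, n ≠ 0 → v X (n * m ^ 2) ≤ tau (m ^ 2) * v X n := by
  induction m using Nat.recOnPosPrimePosCoprime with
  | zero => intro h; exact absurd rfl h
  | one => intro _ n _; simp [tau]
  | prime_pow p k hp hk =>
    intro _ n hn
    have : tau ((p ^ k) ^ 2) = 2 * k + 1 := by
      rw [← pow_mul, tau, Nat.divisors_prime_pow hp]; simp; ring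
    rw [this, ← pow_mul, mul_comm k 2]
    exact v_mul_pp hX hp n k hn
  | coprime a b ha hb hab iha ihb =>
    intro _ n hn
    have ha0 : a ≠ 0 := by omega
    have hb0 : b ≠ 0 := by omega
    have ht : tau ((a * b) ^ 2) = tau (a ^ 2) * tau (b ^ 2) := by
      rw [mul_pow]
      have := Nat.Coprime.card_divisors_mul (Nat.Coprime.pow 2 2 hab)
      unfold tau; rw [this]; push_cast; ring
    have e : n * (a * b) ^ 2 = (n * a ^ 2) * b ^ 2 := by ring
    rw [e, ht]
    calc _ ≤ tau (b ^ 2) * v X (n * a ^ 2) := ihb hb0 _ (by positivity)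
      _ ≤ tau (b ^ 2) * (tau (a ^ 2) * v X n) :=
        mul_le_mul_of_nonneg_left (iha ha0 n hn) (tau_nonneg _)
      _ = _ := by ring

/-- j^omega -/
noncomputable def om (j : ℕ) (n : ℕ) : ℝ := (j : ℝ) ^ n.primeFactors.card

lemma om_nonneg (j n : ℕ) : 0 ≤ om j n := by unfold om; positivity

lemma om_mul (j : ℕ) {a b : ℕ} (h : a.Coprime b) : om j (a * b) = om j a * om j b := by
  unfold om
  rw [h.primeFactors_mul, Finset.card_union_of_disjoint h.disjoint_primeFactors, pow_add]

lemma om_sum (j : ℕ) {n : ℕ} (hn : Squarefree n) :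
    ∑ d ∈ n.divisors, om j d = om (j + 1) n := by
  let f : ArithmeticFunction ℝ := ⟨fun n => if n = 0 then 0 else om j n, by simp⟩
  have hf : f.IsMultiplicative := by
    refine ⟨by simp [f, om], ?_⟩
    intro a b hab
    by_cases hm : a = 0
    · simp [f, hm]
    by_cases hn : b = 0
    · simp [f, hn]
    simp [f, hm, hn, om_mul j hab]
  have := hf.prodPrimeFactors_one_add_of_squarefree hn
  have h2 : ∑ d ∈ n.divisors, f d = ∑ d ∈ n.divisors, om j d := by
    refine Finset.sum_congr rfl fun d hd => ?_
    have : d ≠ 0 := by rintro rfl; simp at hd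
    simp [f, this]
  rw [← h2, ← this]
  have h3 : ∀ p ∈ n.primeFactors, 1 + f p = (j + 1 : ℝ) := by
    intro p hp
    have hp' := Nat.prime_of_mem_primeFactors hp
    simp [f, hp'.ne_zero, om, hp'.primeFactors]; ring
  rw [Finset.prod_congr rfl h3]
  simp [om]

lemma tau_sqf {n : ℕ} (hn : Squarefree n) : tau n = om 2 n := by
  rw [← om_sum 1 hn]; simp [om, tau]

lemma tau_cube_sqf {n : ℕ} (hn : Squarefree n) : tau n ^ 3 = om 8 n := by
  rw [tau_sqf hn]; unfold om; rw [← pow_mul, mul_comm, pow_mul]; norm_num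

/-- harmonic-type sum of v/n -/
noncomputable def HV (X : ℕ → ℝ) (N : ℕ) : ℝ := ∑ n ∈ Icc 1 N, v X n / n
noncomputable def HH (N : ℕ) : ℝ := ∑ n ∈ Icc 1 N, (1 : ℝ) / n

lemma HV_le (hX : RC X) (N : ℕ) : HV X N ≤ HH N ^ 2 := by
  have := sum_tau_pow_le N (fun n => (1 : ℝ) / n) (fun n => by positivity)
    (fun a b => by push_cast; rw [one_div_mul_one_div]) 1
  refine le_trans ?_ (by simpa [HH] using this)
  refine Finset.sum_le_sum fun n _ => ?_
  have := v_le_tau hX n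
  rw [← div_eq_mul_inv]
  gcongr

lemma HV_nonneg (hX : RC X) (N : ℕ) : 0 ≤ HV X N :=
  Finset.sum_nonneg fun n _ => div_nonneg (v_nonneg hX n) (Nat.cast_nonneg n)

open Classical in
lemma sum_om_le (hX : RC X) (N j : ℕ) :
    ∑ r ∈ Icc 1 N, (if Squarefree r then v X r * om (j + 1) r / r else 0) ≤ HV X N ^ (j + 1) := by
  have hn : ∀ j r, 0 ≤ (if Squarefree r then v X r * om j r / r else 0) := by
    intro j r; split_ifs
    · exact div_nonneg (mul_nonneg (v_nonneg hX r) (om_nonneg _ _)) (Nat.cast_nonneg r)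
    · exact le_rfl
  induction j with
  | zero =>
    simp only [zero_add, pow_one]
    refine Finset.sum_le_sum fun r _ => ?_
    split_ifs
    · simp [om]
    · exact div_nonneg (v_nonneg hX r) (Nat.cast_nonneg r)
  | succ j ih =>
    rw [pow_succ']
    refine le_trans ?_ (mul_le_mul_of_nonneg_left ih (HV_nonneg hX N))
    refine le_trans ?_ (conv_le N _ _ (fun n => div_nonneg (v_nonneg hX n) (Nat.cast_nonneg n))
      (hn (j + 1)))
    refine Finset.sum_le_sum fun r _ => ?_
    by_cases hr : Squarefree r
    · rw [if_pos hr, ← om_sum (j + 1) hr, ← Nat.sum_divisorsAntidiagonal' (fun _ b => om (j + 1) b),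
        Finset.mul_sum, Finset.sum_div]
      refine Finset.sum_le_sum fun x hx => ?_
      rw [Nat.mem_divisorsAntidiagonal] at hx
      obtain ⟨hx, h0⟩ := hx
      subst hx
      rw [if_pos (hr.of_mul_right), v_mul hX (Nat.coprime_of_squarefree_mul hr)]
      push_cast
      rw [div_mul_div_comm]
      apply le_of_eq; ring
    · rw [if_neg hr]
      exact Finset.sum_nonneg fun x _ =>
        mul_nonneg (div_nonneg (v_nonneg hX _) (Nat.cast_nonneg _)) (hn _ _)

open Classical in
lemma nonsmooth (hX : RC X) {s p : ℕ} (hs : Squarefree s) (hp : p.Prime) (hps : p ∣ s) (Y : ℝ)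
    (hY : Y < p) :
    v X s * om 8 s / s ≤ 8 * ∑ x ∈ s.divisorsAntidiagonal,
      (if Y < (x.1 : ℝ) then v X x.1 / x.1 else 0) *
        (if Squarefree x.2 then v X x.2 * om 7 x.2 / x.2 else 0) := by
  obtain ⟨q, rfl⟩ := hps
  have hq : Squarefree q := hs.of_mul_right
  have hc := Nat.coprime_of_squarefree_mul hs
  have hq0 : q ≠ 0 := hq.ne_zero
  have e1 : om 8 (p * q) = 8 * ∑ d ∈ q.divisors, om 7 d := by
    rw [om_mul 8 hc, om_sum 7 hq]; simp [om, hp.primeFactors]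
  have hterm : ∀ x : ℕ × ℕ, 0 ≤ (if Y < (x.1 : ℝ) then v X x.1 / x.1 else 0) *
        (if Squarefree x.2 then v X x.2 * om 7 x.2 / x.2 else 0) := by
    intro x
    apply mul_nonneg
    · split_ifs
      · exact div_nonneg (v_nonneg hX _) (Nat.cast_nonneg _)
      · exact le_rfl
    · split_ifs
      · exact div_nonneg (mul_nonneg (v_nonneg hX _) (om_nonneg _ _)) (Nat.cast_nonneg _)
      · exact le_rfl
  have e2 : v X (p * q) * om 8 (p * q) / (p * q : ℕ) =
      8 * ∑ x ∈ q.divisorsAntidiagonal, v X (p * q) * om 7 x.2 / (p * q : ℕ) := by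
    rw [e1, ← Nat.sum_divisorsAntidiagonal' (fun _ b => om 7 b), ← Finset.sum_div,
      ← Finset.mul_sum]; ring
  rw [e2]
  refine mul_le_mul_of_nonneg_left ?_ (by norm_num)
  rw [Nat.sum_divisorsAntidiagonal' (fun a b => v X (p * q) * om 7 b / (p * q : ℕ)),
    Nat.sum_divisorsAntidiagonal' (fun a b => (if Y < (a : ℝ) then v X a / a else 0) *
        (if Squarefree b then v X b * om 7 b / b else 0))]
  refine le_trans ?_ (Finset.sum_le_sum_of_subset_of_nonneg
    (Nat.divisors_subset_of_dvd (mul_ne_zero hp.ne_zero hq0) (dvd_mul_left q p))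
    (fun d _ _ => hterm (p * q / d, d)))
  refine Finset.sum_le_sum fun d hd => ?_
  rw [Nat.mem_divisors] at hd
  obtain ⟨⟨a, rfl⟩, _⟩ := hd
  have hd0 : 0 < d := Nat.pos_of_ne_zero (by rintro rfl; simp at hq0)
  have ha0 : 0 < a := Nat.pos_of_ne_zero (by rintro rfl; simp at hq0)
  have e3 : p * (d * a) = (p * a) * d := by ring
  rw [e3, Nat.mul_div_cancel _ hd0]
  have hs' : Squarefree ((p * a) * d) := by rw [← e3]; exact hs
  have hY' : Y < ((p * a : ℕ) : ℝ) := by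
    push_cast
    have : (1 : ℝ) ≤ a := by exact_mod_cast ha0
    have : (0 : ℝ) ≤ p := Nat.cast_nonneg p
    nlinarith
  rw [if_pos hY', if_pos hs'.of_mul_right, v_mul hX (Nat.coprime_of_squarefree_mul hs')]
  push_cast
  rw [div_mul_div_comm]
  apply le_of_eq; ring

open Classical in
lemma smooth (hX : RC X) {s : ℕ} (hs : Squarefree s) (Y Z : ℝ) (hZ : 1 ≤ Z) (hY : 1 ≤ Y)
    (hp : ∀ p, p.Prime → p ∣ s → (p : ℝ) ≤ Y) (hsZ : Z * Z * Y < s) :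
    v X s * tau s ^ 3 / s ≤ ∑ x ∈ s.divisorsAntidiagonal,
      (if Z < (x.1 : ℝ) then v X x.1 * tau x.1 ^ 3 / x.1 else 0) *
        (if Z < (x.2 : ℝ) then v X x.2 * tau x.2 ^ 3 / x.2 else 0) := by
  have hex : ∃ k, k ∣ s ∧ Z < (k : ℝ) := ⟨s, dvd_rfl, by nlinarith [mul_le_mul hZ hY (by linarith) (by linarith)]⟩
  obtain ⟨hk1, hk2⟩ := Nat.find_spec hex
  have hmin := fun m => Nat.find_min (m := m) hex
  set k := Nat.find hex
  have hs0 : s ≠ 0 := hs.ne_zero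
  have hk0 : k ≠ 0 := by rintro h; rw [h] at hk2; simp at hk2; linarith
  have hk1' : k ≠ 1 := by rintro h; rw [h] at hk2; simp at hk2; linarith
  obtain ⟨p, hpp, a, hpa⟩ := Nat.exists_prime_and_dvd hk1'
  have ha0 : a ≠ 0 := by rintro rfl; simp at hpa; exact hk0 hpa
  have hak : a < k := by
    rw [hpa]; have := hpp.two_le; nlinarith [Nat.pos_of_ne_zero ha0]
  have haZ : (a : ℝ) ≤ Z := by
    by_contra hcon
    exact hmin a hak ⟨(Dvd.intro_left p hpa.symm).trans hk1, not_le.mp hcon⟩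
  have hpY := hp p hpp ((Dvd.intro a hpa.symm).trans hk1)
  have hkle : (k : ℝ) ≤ Y * Z := by
    rw [hpa]; push_cast
    exact mul_le_mul hpY haZ (Nat.cast_nonneg _) (by linarith)
  obtain ⟨l, hl⟩ := hk1
  have hlZ : Z < (l : ℝ) := by
    by_contra hcon
    have h1 : (s : ℝ) = k * l := by rw [hl]; push_cast; ring
    have h2 : (k : ℝ) * l ≤ (Y * Z) * Z :=
      mul_le_mul hkle (not_lt.mp hcon) (Nat.cast_nonneg _) (by positivity)
    nlinarith
  have hterm : ∀ x ∈ s.divisorsAntidiagonal,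
      0 ≤ (if Z < (x.1 : ℝ) then v X x.1 * tau x.1 ^ 3 / x.1 else 0) *
        (if Z < (x.2 : ℝ) then v X x.2 * tau x.2 ^ 3 / x.2 else 0) := by
    intro x _
    have : ∀ n, 0 ≤ v X n * tau n ^ 3 / n := fun n =>
      div_nonneg (mul_nonneg (v_nonneg hX _) (pow_nonneg (tau_nonneg _) _)) (Nat.cast_nonneg _)
    apply mul_nonneg
    · split_ifs
      · exact this _
      · exact le_rfl
    · split_ifs
      · exact this _
      · exact le_rfl
  refine le_trans ?_ (Finset.single_le_sum hterm
    (show (k, l) ∈ s.divisorsAntidiagonal by rw [Nat.mem_divisorsAntidiagonal]; exact ⟨hl.symm, hs0⟩))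
  simp only [if_pos hk2, if_pos hlZ]
  rw [hl] at hs
  have hc := Nat.coprime_of_squarefree_mul hs
  have ht : tau (k * l) = tau k * tau l := by
    rw [tau_sqf hs, tau_sqf hs.of_mul_left, tau_sqf hs.of_mul_right, om_mul 2 hc]
  rw [hl, v_mul hX hc, ht]
  push_cast
  rw [div_mul_div_comm]
  apply le_of_eq; ring

end Aux3

namespace Aux3
open Finset
variable {X : ℕ → ℝ}

/-- partial sums of v -/
noncomputable def W (X : ℕ → ℝ) (N : ℕ) : ℝ := ∑ n ∈ Icc 1 N, v X n

lemma W_eq (N : ℕ) : W X N = ∑ d ∈ Icc 1 N, X d * ((N / d : ℕ) : ℝ) := by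
  have h : ∀ n ∈ Icc 1 N, v X n = ∑ d ∈ Icc 1 N, if d ∣ n then X d else 0 := by
    intro n hn
    rw [Finset.mem_Icc] at hn
    rw [← Finset.sum_filter]
    unfold v
    refine Finset.sum_congr ?_ fun _ _ => rfl
    ext d
    simp only [Nat.mem_divisors, Finset.mem_filter, Finset.mem_Icc]
    constructor
    · rintro ⟨h1, h2⟩
      have := Nat.le_of_dvd (by omega) h1
      have := Nat.pos_of_dvd_of_pos h1 (by omega)
      exact ⟨⟨by omega, by omega⟩, h1⟩
    · rintro ⟨_, h1⟩; exact ⟨h1, by omega⟩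
  unfold W
  rw [Finset.sum_congr rfl h, Finset.sum_comm]
  refine Finset.sum_congr rfl fun d hd => ?_
  rw [← Finset.sum_filter, Finset.sum_const, nsmul_eq_mul, mul_comm]
  congr 2
  have := Nat.Ioc_filter_dvd_card_eq_div N d
  rw [← this]; rfl

/-- hyperbola -/
lemma W_le (hX : RC X) (N D U : ℕ) (hU : 0 < U) (L : ℝ)
    (hS : ∀ a b : ℕ, |∑ d ∈ Ioc a b, X d| ≤ D)
    (hL : ∑ d ∈ Icc 1 U, X d / d ≤ L + D / U) :
    W X N ≤ N * L + 2 * (N * D / U) + U := by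
  have hUr : (0 : ℝ) < U := by exact_mod_cast hU
  -- first part
  have h1 : ∑ d ∈ Icc 1 U, X d * ((N / d : ℕ) : ℝ) ≤ N * (L + D / U) + U := by
    have : ∀ d ∈ Icc 1 U, X d * ((N / d : ℕ) : ℝ) ≤ N * (X d / d) + 1 := by
      intro d hd
      rw [Finset.mem_Icc] at hd
      have hd' : (0 : ℝ) < d := by exact_mod_cast hd.1
      have a1 : ((N / d : ℕ) : ℝ) ≤ N / d := Nat.cast_div_le
      have a2 : (N : ℝ) / d - 1 ≤ ((N / d : ℕ) : ℝ) := by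
        have : N < d * (N / d + 1) := Nat.lt_mul_div_succ N (by omega)
        have : (N : ℝ) < d * ((N / d : ℕ) + 1) := by exact_mod_cast this
        rw [sub_le_iff_le_add, div_le_iff₀ hd']
        linarith
      have e : N * (X d / d) = X d * (N / d) := by ring
      rw [e]
      rcases hX.val d with h | h | h <;> rw [h] <;> linarith
    calc _ ≤ ∑ d ∈ Icc 1 U, (N * (X d / d) + 1) := Finset.sum_le_sum this
      _ = N * (∑ d ∈ Icc 1 U, X d / d) + U := by
        rw [Finset.sum_add_distrib, Finset.mul_sum]; simp
      _ ≤ _ := by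
        have : (0 : ℝ) ≤ N := Nat.cast_nonneg N
        gcongr
  -- second part
  have h2 : ∑ d ∈ Ioc U N, X d * ((N / d : ℕ) : ℝ) ≤ N * D / U := by
    have e : ∀ d ∈ Ioc U N, X d * ((N / d : ℕ) : ℝ) =
        ∑ e ∈ Icc 1 (N / U), if e * d ≤ N then X d else 0 := by
      intro d hd
      rw [Finset.mem_Ioc] at hd
      rw [← Finset.sum_filter, Finset.sum_const, nsmul_eq_mul, mul_comm]
      congr 2
      have : (Icc 1 (N / U)).filter (fun e => e * d ≤ N) = Icc 1 (N / d) := by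
        ext e
        simp only [Finset.mem_filter, Finset.mem_Icc]
        rw [Nat.le_div_iff_mul_le (by omega), Nat.le_div_iff_mul_le (by omega)]
        constructor
        · rintro ⟨⟨h1, _⟩, h2⟩; exact ⟨h1, h2⟩
        · rintro ⟨h1, h2⟩
          exact ⟨⟨h1, le_trans (Nat.mul_le_mul_left e hd.1.le) h2⟩, h2⟩
      rw [this]; simp
    rw [Finset.sum_congr rfl e, Finset.sum_comm]
    have b : ∀ e ∈ Icc 1 (N / U), (∑ d ∈ Ioc U N, if e * d ≤ N then X d else 0) ≤ D := by
      intro e he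
      rw [Finset.mem_Icc] at he
      rw [← Finset.sum_filter]
      have : (Ioc U N).filter (fun d => e * d ≤ N) = Ioc U (N / e) := by
        ext d
        simp only [Finset.mem_filter, Finset.mem_Ioc]
        rw [Nat.le_div_iff_mul_le (by omega), mul_comm d e]
        constructor
        · rintro ⟨⟨h1, _⟩, h2⟩; exact ⟨h1, h2⟩
        · rintro ⟨h1, h2⟩
          refine ⟨⟨h1, ?_⟩, h2⟩
          nlinarith
      rw [this]
      exact (abs_le.mp (hS _ _)).2
    calc _ ≤ ∑ e ∈ Icc 1 (N / U), (D : ℝ) := Finset.sum_le_sum b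
      _ = ((N / U : ℕ) : ℝ) * D := by simp
      _ ≤ (N / U) * D := by gcongr; exact Nat.cast_div_le
      _ = _ := by ring
  -- combine
  have h3 : W X N = ∑ d ∈ Icc 1 U, X d * ((N / d : ℕ) : ℝ) + ∑ d ∈ Ioc U N, X d * ((N / d : ℕ) : ℝ) := by
    rw [W_eq]
    rcases le_total U N with h | h
    · have : Icc 1 N = Icc 1 U ∪ Ioc U N := by
        ext d; simp only [Finset.mem_union, Finset.mem_Icc, Finset.mem_Ioc]; omega
      rw [this, Finset.sum_union]
      rw [Finset.disjoint_left]; intro d; simp only [Finset.mem_Icc, Finset.mem_Ioc]; omega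
    · rw [Finset.Ioc_eq_empty_of_le h, Finset.sum_empty, add_zero]
      refine Finset.sum_subset (Finset.Icc_subset_Icc_right h) ?_
      intro d hd hd'
      simp only [Finset.mem_Icc] at hd hd'
      have : N / d = 0 := Nat.div_eq_of_lt (by omega)
      simp [this]
  rw [h3]
  have e : N * (L + D / U) + U + N * D / U = N * L + 2 * (N * D / U) + U := by ring
  linarith

lemma W_le' (hX : RC X) (N D : ℕ) (hN : 0 < N) (hD : 0 < D) (L : ℝ)
    (hS : ∀ a b : ℕ, |∑ d ∈ Ioc a b, X d| ≤ D)
    (hL : ∀ U : ℕ, 0 < U → ∑ d ∈ Icc 1 U, X d / d ≤ L + D / U) :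
    W X N ≤ N * L + 4 * Real.sqrt (N * D) := by
  have h := W_le hX N D (Nat.sqrt (N * D) + 1) (by omega) L hS (hL _ (by omega))
  set q := Real.sqrt (N * D) with hq
  have hND : (1 : ℝ) ≤ (N * D : ℝ) := by
    have : 1 ≤ N * D := Nat.mul_pos hN hD
    exact_mod_cast this
  have hq1 : 1 ≤ q := by rw [hq]; exact Real.one_le_sqrt.mpr hND
  have hqq : q * q = N * D := Real.mul_self_sqrt (by linarith)
  have hu1 : q ≤ ((Nat.sqrt (N * D) + 1 : ℕ) : ℝ) := by
    have := Real.real_sqrt_le_nat_sqrt_succ (a := N * D)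
    push_cast at this ⊢
    exact this
  have hu2 : ((Nat.sqrt (N * D) + 1 : ℕ) : ℝ) ≤ q + 1 := by
    have := Real.nat_sqrt_le_real_sqrt (a := N * D)
    push_cast at this ⊢
    linarith
  set u := ((Nat.sqrt (N * D) + 1 : ℕ) : ℝ)
  have h3 : (N * D : ℝ) / u ≤ q := by
    rw [div_le_iff₀ (by linarith), ← hqq]
    exact mul_le_mul_of_nonneg_left hu1 (by linarith)
  linarith

open Classical in
lemma R_le (hX : RC X) (Y κ : ℝ) (hY : 1 ≤ Y) (hκ : 0 ≤ κ) (hW : ∀ n : ℕ, Y < n → W X n ≤ κ * n) (N : ℕ) :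
    ∑ n ∈ Icc 1 N, (if Y < (n : ℝ) then v X n / n else 0) ≤ κ * (1 + HH N) := by
  have hW0 : ∀ n, 0 ≤ W X n := fun n => Finset.sum_nonneg fun i _ => v_nonneg hX i
  have hH0 : ∀ n, 0 ≤ HH n := fun n => Finset.sum_nonneg fun i _ => by positivity
  have key : ∀ N : ℕ, ∑ n ∈ Icc 1 N, (if Y < (n : ℝ) then v X n / n else 0) ≤ W X N / N + κ * HH N ∧
      ((N : ℝ) ≤ Y → ∑ n ∈ Icc 1 N, (if Y < (n : ℝ) then v X n / n else 0) = 0) := by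
    intro N
    have hz : ((N : ℝ) ≤ Y → ∑ n ∈ Icc 1 N, (if Y < (n : ℝ) then v X n / n else 0) = 0) := by
      intro h
      refine Finset.sum_eq_zero fun n hn => ?_
      rw [Finset.mem_Icc] at hn
      have : (n : ℝ) ≤ N := by exact_mod_cast hn.2
      rw [if_neg (by linarith)]
    refine ⟨?_, hz⟩
    induction N with
    | zero => simp [W, HH]
    | succ N ih =>
      have hW1 : W X (N + 1) = W X N + v X (N + 1) := by
        unfold W; rw [Finset.sum_Icc_succ_top (by omega)]
      have hH1 : HH (N + 1) = HH N + 1 / ((N + 1 : ℕ) : ℝ) := by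
        unfold HH; rw [Finset.sum_Icc_succ_top (by omega)]
      have hpos : (0 : ℝ) < ((N + 1 : ℕ) : ℝ) := by positivity
      by_cases h : ((N + 1 : ℕ) : ℝ) ≤ Y
      · rw [hz h]
        exact add_nonneg (div_nonneg (hW0 _) hpos.le) (mul_nonneg hκ (hH0 _))
      · rw [Finset.sum_Icc_succ_top (by omega), if_pos (not_le.mp h)]
        by_cases h' : (N : ℝ) ≤ Y
        · have : ∑ n ∈ Icc 1 N, (if Y < (n : ℝ) then v X n / n else 0) = 0 := by
            refine Finset.sum_eq_zero fun n hn => ?_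
            rw [Finset.mem_Icc] at hn
            have : (n : ℝ) ≤ N := by exact_mod_cast hn.2
            rw [if_neg (by linarith)]
          rw [this, zero_add]
          have h5 : v X (N + 1) / ((N + 1 : ℕ) : ℝ) ≤ W X (N + 1) / ((N + 1 : ℕ) : ℝ) := by
            gcongr; rw [hW1]; linarith [hW0 N]
          linarith [mul_nonneg hκ (hH0 (N + 1))]
        · have hNY := not_le.mp h'
          have hN0 : (0 : ℝ) < N := by linarith
          have ih' := ih (fun h => absurd h h')
          have h6 : W X N / N ≤ κ := by rw [div_le_iff₀ hN0]; exact hW N hNY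
          have h7 : W X N / N = W X N / ((N + 1 : ℕ) : ℝ) + (W X N / N) * (1 / ((N + 1 : ℕ) : ℝ)) := by
            push_cast; field_simp
          have h8 : (W X N / N) * (1 / ((N + 1 : ℕ) : ℝ)) ≤ κ * (1 / ((N + 1 : ℕ) : ℝ)) :=
            mul_le_mul_of_nonneg_right h6 (by positivity)
          rw [hW1, hH1, add_div, mul_add]
          linarith
  by_cases h : (N : ℝ) ≤ Y
  · rw [(key N).2 h]; exact mul_nonneg hκ (by linarith [hH0 N])
  · have hNY := not_le.mp h
    have hN0 : (0 : ℝ) < N := by linarith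
    have h6 : W X N / N ≤ κ := by rw [div_le_iff₀ hN0]; exact hW N hNY
    linarith [(key N).1]

/-- Abel lower bound -/
lemma abel_lower (D : ℕ) (hS : ∀ a b : ℕ, |∑ d ∈ Ioc a b, X d| ≤ D) (a : ℕ → ℝ)
    (ha0 : ∀ n, 0 ≤ a n) (U : ℕ) (ha : ∀ n, U ≤ n → a (n + 1) ≤ a n) (V : ℕ) (hV : U ≤ V) :
    -(D * a U) ≤ ∑ d ∈ Ioc U V, X d * a d := by
  have key : (∑ d ∈ Ioc U V, X d) * a V - D * (a U - a V) ≤ ∑ d ∈ Ioc U V, X d * a d := by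
    induction V, hV using Nat.le_induction with
    | base => simp
    | succ V hV ih =>
      rw [Finset.sum_Ioc_succ_top hV, Finset.sum_Ioc_succ_top hV]
      have h1 := (abs_le.mp (hS U V)).1
      have h2 := ha V hV
      nlinarith
  have h1 := (abs_le.mp (hS U V)).1
  have h2 := ha0 V
  nlinarith

end Aux3

namespace Aux3
open Finset

/-- real part of the character -/
noncomputable def XX {D : ℕ} (χ : DirichletCharacter ℂ D) (n : ℕ) : ℝ := (χ (n : ZMod D)).re

lemma XX_eq {D : ℕ} (χ : DirichletCharacter ℂ D) (h : ∀ a : ZMod D, (χ a).im = 0) (n : ℕ) :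
    χ (n : ZMod D) = (XX χ n : ℂ) := by
  apply Complex.ext <;> simp [XX, h]

lemma XX_RC {D : ℕ} (χ : DirichletCharacter ℂ D) (h : ∀ a : ZMod D, (χ a).im = 0) : RC (XX χ) where
  one := by simp [XX]
  mul a b := by
    unfold XX
    push_cast
    rw [map_mul, Complex.mul_re, h, h]; ring
  val n := by
    by_cases hu : IsUnit (n : ZMod D)
    · obtain ⟨u, hu⟩ := hu
      have h1 := DirichletCharacter.unit_norm_eq_one χ u
      rw [hu, XX_eq χ h, Complex.norm_real, Real.norm_eq_abs] at h1
      right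
      exact eq_or_eq_neg_of_abs_eq h1
    · left; unfold XX; rw [MulChar.map_nonunit _ hu]; simp

lemma XX_sum {D : ℕ} [NeZero D] (χ : DirichletCharacter ℂ D) (hχ : χ ≠ 1)
    (hr : ∀ a : ZMod D, (χ a).im = 0) (a b : ℕ) : |∑ d ∈ Ioc a b, XX χ d| ≤ D := by
  have hper : ∀ n, XX χ (n + D) = XX χ n := by intro n; simp [XX]
  have hD : 0 < D := Nat.pos_of_ne_zero (NeZero.ne D)
  have h0 : ∑ i ∈ range D, XX χ i = 0 := by
    have h1 : ∑ x : ZMod D, (χ x).re = 0 := by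
      rw [← Complex.re_sum, MulChar.sum_eq_zero_of_ne_one hχ]; simp
    rw [← h1]
    refine Finset.sum_bij (fun i _ => (i : ZMod D)) (by simp) ?_ ?_ (fun i _ => rfl)
    · intro i hi j hj hij
      rw [Finset.mem_range] at hi hj
      have := (ZMod.natCast_eq_natCast_iff' i j D).mp hij
      rwa [Nat.mod_eq_of_lt hi, Nat.mod_eq_of_lt hj] at this
    · intro x _
      exact ⟨x.val, by simp [ZMod.val_lt], by simp⟩
  have h1 : ∀ a, ∑ i ∈ range D, XX χ (a + i) = 0 := by
    intro a
    induction a with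
    | zero => simpa using h0
    | succ a ih =>
      have e1 := Finset.sum_range_succ (fun i => XX χ (a + i)) D
      have e2 := Finset.sum_range_succ' (fun i => XX χ (a + i)) D
      have e3 := hper a
      have e4 : ∑ i ∈ range D, XX χ (a + 1 + i) = ∑ i ∈ range D, XX χ (a + (i + 1)) :=
        Finset.sum_congr rfl fun i _ => by rw [add_assoc, add_comm 1 i]
      rw [e4]
      simp only [add_zero] at e2
      linarith
  have h2 : ∀ n a, |∑ i ∈ range n, XX χ (a + i)| ≤ D := by
    intro n
    induction n using Nat.strong_induction_on with
    | _ n ih =>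
      intro a
      by_cases hn : n < D
      · calc _ ≤ ∑ i ∈ range n, |XX χ (a + i)| := Finset.abs_sum_le_sum_abs _ _
          _ ≤ ∑ i ∈ range n, (1 : ℝ) := Finset.sum_le_sum fun i _ => by
            rcases (XX_RC χ hr).val (a + i) with h | h | h <;> rw [h] <;> norm_num
          _ = n := by simp
          _ ≤ D := by exact_mod_cast hn.le
      · obtain ⟨m, rfl⟩ := Nat.exists_eq_add_of_le (not_lt.mp hn)
        rw [Finset.sum_range_add, h1, zero_add]
        have := ih m (by omega) (a + D)
        simpa [add_assoc] using this
  have h3 : Ioc a b = Ico (a + 1) (b + 1) := by ext; simp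
  rw [h3, Finset.sum_Ico_eq_sum_range]
  exact h2 _ _

open Filter Topology in
lemma L_lower {D : ℕ} [NeZero D] (χ : DirichletCharacter ℂ D) (hχ : χ ≠ 1)
    (hr : ∀ a : ZMod D, (χ a).im = 0) (U : ℕ) (hU : 0 < U) :
    ∑ d ∈ Icc 1 U, XX χ d / d ≤ (DirichletCharacter.LFunction χ 1).re + D / U := by
  have hS := XX_sum χ hχ hr
  -- for real s > 1
  have h1 : ∀ s : ℝ, 1 < s → ∑ d ∈ Icc 1 U, XX χ d * (d : ℝ) ^ (-s) - D * (U : ℝ) ^ (-s) ≤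
      (DirichletCharacter.LFunction χ (s : ℂ)).re := by
    intro s hs
    have hs' : 1 < (s : ℂ).re := by simpa using hs
    rw [DirichletCharacter.LFunction_eq_LSeries χ hs']
    have hsum := (DirichletCharacter.LSeriesSummable_of_one_lt_re χ hs').LSeriesHasSum
    have hsum2 := Complex.reCLM.hasSum hsum
    have ht := hsum2.tendsto_sum_nat
    have hterm : ∀ n : ℕ, n ≠ 0 → (LSeries.term (fun n => χ (n : ZMod D)) (s : ℂ) n).re = XX χ n * (n : ℝ) ^ (-s) := by
      intro n hn
      rw [LSeries.term_of_ne_zero hn, XX_eq χ hr, Real.rpow_neg (Nat.cast_nonneg n),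
        ← div_eq_mul_inv, ← Complex.ofReal_natCast, ← Complex.ofReal_cpow (Nat.cast_nonneg n),
        ← Complex.ofReal_div, Complex.ofReal_re]
    refine ge_of_tendsto ht ?_
    filter_upwards [eventually_ge_atTop (U + 1)] with V hV
    obtain ⟨V, rfl⟩ : ∃ V', V = V' + 1 := ⟨V - 1, by omega⟩
    have e : ∑ i ∈ range (V + 1), Complex.reCLM (LSeries.term (fun n => χ (n : ZMod D)) (s : ℂ) i) =
        ∑ d ∈ Icc 1 U, XX χ d * (d : ℝ) ^ (-s) + ∑ d ∈ Ioc U V, XX χ d * (d : ℝ) ^ (-s) := by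
      have : range (V + 1) = insert 0 (Icc 1 U ∪ Ioc U V) := by
        ext d; simp; omega
      rw [this, Finset.sum_insert (by simp), Finset.sum_union]
      · simp only [Complex.reCLM_apply, LSeries.term_zero, Complex.zero_re, zero_add]
        congr 1
        · refine Finset.sum_congr rfl fun d hd => hterm d ?_
          rw [Finset.mem_Icc] at hd; omega
        · refine Finset.sum_congr rfl fun d hd => hterm d ?_
          rw [Finset.mem_Ioc] at hd; omega
      · rw [Finset.disjoint_left]; intro d; simp only [Finset.mem_Icc, Finset.mem_Ioc]; omega
    rw [e]
    have := abel_lower D hS (fun d => (d : ℝ) ^ (-s)) (fun n => by positivity) U (by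
      intro n hn
      apply Real.rpow_le_rpow_of_nonpos
      · exact_mod_cast (by omega : 0 < n)
      · push_cast; linarith
      · linarith) V (by omega)
    linarith
  -- limit s → 1+
  have hc : Continuous (fun s : ℝ => (DirichletCharacter.LFunction χ (s : ℂ)).re) :=
    Complex.continuous_re.comp ((DirichletCharacter.differentiable_LFunction hχ).continuous.comp
      Complex.continuous_ofReal)
  have hp : ∀ d : ℕ, 0 < d → Continuous (fun s : ℝ => (d : ℝ) ^ (-s)) := by
    intro d hd
    exact Continuous.rpow continuous_const continuous_neg (fun s => Or.inl (by positivity))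
  have hc2 : Continuous (fun s : ℝ => ∑ d ∈ Icc 1 U, XX χ d * (d : ℝ) ^ (-s) - D * (U : ℝ) ^ (-s)) := by
    refine Continuous.sub (continuous_finsetSum _ fun d hd => ?_) (continuous_const.mul (hp U hU))
    rw [Finset.mem_Icc] at hd
    exact continuous_const.mul (hp d (by omega))
  have h2 := le_of_tendsto_of_tendsto (b := 𝓝[>] (1 : ℝ)) ((hc2.tendsto 1).mono_left nhdsWithin_le_nhds)
    ((hc.tendsto 1).mono_left nhdsWithin_le_nhds)
    (by filter_upwards [self_mem_nhdsWithin] with s hs using h1 s hs)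
  simp only [Real.rpow_neg_one, Complex.ofReal_one] at h2
  simp only [div_eq_mul_inv]
  linarith

lemma ne_one_of_primitive {D : ℕ} [NeZero D] (χ : DirichletCharacter ℂ D) (hD : 2 ≤ D)
    (h : χ.IsPrimitive) : χ ≠ 1 := by
  rintro rfl
  rw [DirichletCharacter.isPrimitive_def, DirichletCharacter.conductor_one] at h
  omega

end Aux3

namespace Aux3
open Finset
variable {X : ℕ → ℝ}

open Classical in
noncomputable def RR (X : ℕ → ℝ) (Y : ℝ) (N : ℕ) : ℝ :=
  ∑ n ∈ Icc 1 N, (if Y < (n : ℝ) then v X n / n else 0)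

open Classical in
noncomputable def QQ (X : ℕ → ℝ) (Y : ℝ) (N : ℕ) : ℝ :=
  ∑ n ∈ Icc 1 N, (if Y < (n : ℝ) then v X n * tau n ^ 3 / n else 0)

open Classical in
noncomputable def SM (X : ℕ → ℝ) (T : ℝ) (N : ℕ) : ℝ :=
  ∑ s ∈ Icc 1 N, (if Squarefree s ∧ T < (s : ℝ) then v X s * tau s ^ 3 / s else 0)

lemma vt_nonneg (hX : RC X) (n : ℕ) : 0 ≤ v X n * tau n ^ 3 / n :=
  div_nonneg (mul_nonneg (v_nonneg hX _) (pow_nonneg (tau_nonneg _) _)) (Nat.cast_nonneg _)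

lemma RR_nonneg (hX : RC X) (Y : ℝ) (N : ℕ) : 0 ≤ RR X Y N :=
  Finset.sum_nonneg fun n _ => by
    split_ifs
    · exact div_nonneg (v_nonneg hX n) (Nat.cast_nonneg n)
    · exact le_rfl

lemma QQ_nonneg (hX : RC X) (Y : ℝ) (N : ℕ) : 0 ≤ QQ X Y N :=
  Finset.sum_nonneg fun n _ => by
    split_ifs
    · exact vt_nonneg hX n
    · exact le_rfl

lemma SM_nonneg (hX : RC X) (Y : ℝ) (N : ℕ) : 0 ≤ SM X Y N :=
  Finset.sum_nonneg fun n _ => by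
    split_ifs
    · exact vt_nonneg hX n
    · exact le_rfl

open Classical in
lemma SM_le (hX : RC X) (Y : ℝ) (hY : 1 ≤ Y) (N : ℕ) :
    SM X (Y * Y * Y) N ≤ 8 * (RR X Y N * HV X N ^ 7) + QQ X Y N ^ 2 := by
  let g1 : ℕ → ℝ := fun n => if Y < (n : ℝ) then v X n / n else 0
  let g2 : ℕ → ℝ := fun n => if Squarefree n then v X n * om 7 n / n else 0
  let g3 : ℕ → ℝ := fun n => if Y < (n : ℝ) then v X n * tau n ^ 3 / n else 0
  have h1 : ∀ n, 0 ≤ g1 n := fun n => by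
    simp only [g1]; split_ifs
    · exact div_nonneg (v_nonneg hX n) (Nat.cast_nonneg n)
    · exact le_rfl
  have h2 : ∀ n, 0 ≤ g2 n := fun n => by
    simp only [g2]; split_ifs
    · exact div_nonneg (mul_nonneg (v_nonneg hX _) (om_nonneg _ _)) (Nat.cast_nonneg n)
    · exact le_rfl
  have h3 : ∀ n, 0 ≤ g3 n := fun n => by
    simp only [g3]; split_ifs
    · exact vt_nonneg hX n
    · exact le_rfl
  have a1 : ∑ n ∈ Icc 1 N, ∑ x ∈ n.divisorsAntidiagonal, g1 x.1 * g2 x.2 ≤ RR X Y N * HV X N ^ 7 := by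
    refine (conv_le N g1 g2 h1 h2).trans ?_
    exact mul_le_mul_of_nonneg_left (sum_om_le hX N 6) (RR_nonneg hX Y N)
  have a2 : ∑ n ∈ Icc 1 N, ∑ x ∈ n.divisorsAntidiagonal, g3 x.1 * g3 x.2 ≤ QQ X Y N ^ 2 := by
    rw [sq]; exact conv_le N g3 g3 h3 h3
  calc SM X (Y * Y * Y) N ≤ ∑ n ∈ Icc 1 N, (8 * ∑ x ∈ n.divisorsAntidiagonal, g1 x.1 * g2 x.2 +
        ∑ x ∈ n.divisorsAntidiagonal, g3 x.1 * g3 x.2) := by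
        refine Finset.sum_le_sum fun s hs => ?_
        have n1 : 0 ≤ ∑ x ∈ s.divisorsAntidiagonal, g1 x.1 * g2 x.2 :=
          Finset.sum_nonneg fun x _ => mul_nonneg (h1 _) (h2 _)
        have n2 : 0 ≤ ∑ x ∈ s.divisorsAntidiagonal, g3 x.1 * g3 x.2 :=
          Finset.sum_nonneg fun x _ => mul_nonneg (h3 _) (h3 _)
        split_ifs with hc
        · obtain ⟨hsq, hT⟩ := hc
          by_cases hp : ∀ p, p.Prime → p ∣ s → (p : ℝ) ≤ Y
          · have := smooth hX hsq Y Y hY hY hp hT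
            linarith
          · push Not at hp
            obtain ⟨p, hp, hps, hpY⟩ := hp
            have := nonsmooth hX hsq hp hps Y hpY
            rw [tau_cube_sqf hsq]
            linarith
        · linarith
    _ ≤ _ := by
        rw [Finset.sum_add_distrib, ← Finset.mul_sum]
        linarith

lemma tau_sum_le (N j : ℕ) : ∑ n ∈ Icc 1 N, tau n ^ j / n ≤ HH N ^ (2 ^ j) := by
  have := sum_tau_pow_le N (fun n => (1 : ℝ) / n) (fun n => by positivity)
    (fun a b => by push_cast; rw [one_div_mul_one_div]) j
  simpa [HH, div_eq_mul_inv] using this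

open Classical in
lemma QQ_le (hX : RC X) (Y B : ℝ) (hB : 0 < B) (N : ℕ) :
    QQ X Y N ≤ B ^ 3 * RR X Y N + HH N ^ 256 / B ^ 4 := by
  have h8 : ∑ n ∈ Icc 1 N, tau n ^ 8 / n ≤ HH N ^ 256 := tau_sum_le N 8
  calc QQ X Y N ≤ ∑ n ∈ Icc 1 N, (B ^ 3 * (if Y < (n : ℝ) then v X n / n else 0) +
        (tau n ^ 8 / n) / B ^ 4) := by
        refine Finset.sum_le_sum fun n hn => ?_
        have hn0 : (0 : ℝ) ≤ n := Nat.cast_nonneg n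
        have ht := tau_nonneg n
        have hv := v_nonneg hX n
        split_ifs with h
        · have key : v X n * tau n ^ 3 ≤ B ^ 3 * v X n + tau n ^ 8 / B ^ 4 := by
            rcases le_total (tau n) B with hb | hb
            · have : tau n ^ 3 ≤ B ^ 3 := pow_le_pow_left₀ ht hb 3
              have h5 : 0 ≤ tau n ^ 8 / B ^ 4 := by positivity
              nlinarith
            · have h4 : B ^ 4 ≤ tau n ^ 4 := pow_le_pow_left₀ hB.le hb 4
              have h5 : v X n * tau n ^ 3 ≤ tau n ^ 8 / B ^ 4 := by
                rw [le_div_iff₀ (by positivity)]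
                calc v X n * tau n ^ 3 * B ^ 4 ≤ tau n * tau n ^ 3 * tau n ^ 4 := by
                      gcongr; exact v_le_tau hX n
                  _ = _ := by ring
              have : 0 ≤ B ^ 3 * v X n := by positivity
              linarith
          calc v X n * tau n ^ 3 / n ≤ (B ^ 3 * v X n + tau n ^ 8 / B ^ 4) / n := by gcongr
            _ = _ := by ring
        · positivity
    _ = B ^ 3 * RR X Y N + (∑ n ∈ Icc 1 N, tau n ^ 8 / n) / B ^ 4 := by
        rw [Finset.sum_add_distrib, ← Finset.mul_sum, ← Finset.sum_div]; rfl
    _ ≤ _ := by gcongr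

noncomputable def KS : ℝ := (∑' m : ℕ, (m : ℝ) ^ (-(3 / 2) : ℝ)) ^ 256

lemma KS_nonneg : 0 ≤ KS := by
  unfold KS
  exact pow_nonneg (tsum_nonneg fun m => by positivity) _

lemma tau32_le (N : ℕ) : ∑ m ∈ Icc 1 N, tau m ^ 8 * (m : ℝ) ^ (-(3 / 2) : ℝ) ≤ KS := by
  refine (sum_tau_pow_le N (fun m => (m : ℝ) ^ (-(3 / 2) : ℝ)) (fun n => by positivity)
    (fun a b => by push_cast; rw [Real.mul_rpow (Nat.cast_nonneg _) (Nat.cast_nonneg _)]) 8).trans ?_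
  unfold KS
  refine pow_le_pow_left₀ (Finset.sum_nonneg fun n _ => by positivity) ?_ _
  refine Summable.sum_le_tsum _ (fun n _ => by positivity) ?_
  rw [Real.summable_nat_rpow]; norm_num

open Classical in
lemma total (hX : RC X) (M N : ℕ) (T E : ℝ) (hE : 1 ≤ E) (hT : T * E ^ 4 ≤ M) :
    ∑ n ∈ Ioc M N, v X n ^ 2 * tau n ^ 2 / n ≤ KS * SM X T N + KS / E * HH N ^ 16 := by
  let F : ℕ × ℕ → ℝ := fun x => if Squarefree x.1 ∧ (M : ℝ) < x.1 * (x.2 : ℝ) ^ 2 then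
    (v X x.1 * tau x.1 ^ 3 / x.1) * (tau x.2 ^ 8 / (x.2 : ℝ) ^ 2) else 0
  have hF : ∀ x, 0 ≤ F x := fun x => by
    simp only [F]; split_ifs
    · have := vt_nonneg hX x.1
      have := tau_nonneg x.2
      positivity
    · exact le_rfl
  have step1 : ∑ n ∈ Ioc M N, v X n ^ 2 * tau n ^ 2 / n ≤ ∑ x ∈ Icc 1 N ×ˢ Icc 1 N, F x := by
    refine le_trans ?_ (fiber_le (Icc 1 N ×ˢ Icc 1 N) (fun x => x.1 * x.2 ^ 2) F (fun x _ => hF x)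
      (Ioc M N))
    refine Finset.sum_le_sum fun n hn => ?_
    rw [Finset.mem_Ioc] at hn
    obtain ⟨s, m, hs0, hm0, hsm, hsq⟩ := Nat.sq_mul_squarefree_of_pos (show 0 < n by omega)
    have hn' : s * m ^ 2 = n := by rw [← hsm]; ring
    have hsN : s ≤ n := Nat.le_of_dvd (by omega) ⟨_, hn'.symm⟩
    have hmN : m ≤ n := Nat.le_of_dvd (by omega) ⟨s * m, by rw [← hn']; ring⟩
    have hmem : (s, m) ∈ (Icc 1 N ×ˢ Icc 1 N).filter (fun x => x.1 * x.2 ^ 2 = n) := by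
      simp only [Finset.mem_filter, Finset.mem_product, Finset.mem_Icc]
      exact ⟨⟨⟨by omega, by omega⟩, by omega, by omega⟩, hn'⟩
    refine le_trans ?_ (Finset.single_le_sum (fun x _ => hF x) hmem)
    have hMn : (M : ℝ) < s * (m : ℝ) ^ 2 := by
      have : M < s * m ^ 2 := by omega
      exact_mod_cast this
    simp only [F]
    rw [if_pos ⟨hsq, hMn⟩, ← hn']
    have hv := v_mul_sq hX m (by omega) s (by omega)
    have ht := tau_mul_le s (m ^ 2)
    have ht2 : tau (m ^ 2) ≤ tau m ^ 2 := by rw [sq, sq]; exact tau_mul_le m m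
    have hvs := v_le_tau hX s
    have hv0 := v_nonneg hX s
    have t0 := tau_nonneg s
    have t1 := tau_nonneg m
    have t2 := tau_nonneg (m ^ 2)
    have hv' : v X (s * m ^ 2) ≤ tau m ^ 2 * v X s := hv.trans (by gcongr)
    have ht' : tau (s * m ^ 2) ≤ tau s * tau m ^ 2 := ht.trans (by gcongr)
    have hm0' : (0 : ℝ) < m := by exact_mod_cast hm0
    have hs0' : (0 : ℝ) < s := by exact_mod_cast hs0
    rw [div_mul_div_comm]
    push_cast
    refine div_le_div_of_nonneg_right ?_ (by positivity)
    calc v X (s * m ^ 2) ^ 2 * tau (s * m ^ 2) ^ 2 ≤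
        (tau m ^ 2 * v X s) ^ 2 * (tau s * tau m ^ 2) ^ 2 := by
          gcongr
          · exact v_nonneg hX _
          · exact tau_nonneg _
      _ = (v X s * v X s) * (tau s ^ 2 * tau m ^ 8) := by ring
      _ ≤ (v X s * tau s) * (tau s ^ 2 * tau m ^ 8) := by gcongr
      _ = _ := by ring
  have step2 : ∀ x ∈ Icc 1 N ×ˢ Icc 1 N, F x ≤
      (if Squarefree x.1 ∧ T < (x.1 : ℝ) then v X x.1 * tau x.1 ^ 3 / x.1 else 0) *
        (tau x.2 ^ 8 * (x.2 : ℝ) ^ (-(3 / 2) : ℝ)) +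
      (tau x.1 ^ 4 / x.1) * (tau x.2 ^ 8 * (x.2 : ℝ) ^ (-(3 / 2) : ℝ) / E) := by
    rintro ⟨s, m⟩ hx
    simp only [Finset.mem_product, Finset.mem_Icc] at hx
    obtain ⟨⟨hs1, _⟩, hm1, _⟩ := hx
    have hm0 : (0 : ℝ) < m := by exact_mod_cast hm1
    have hm1' : (1 : ℝ) ≤ m := by exact_mod_cast hm1
    have hs0 : (0 : ℝ) < s := by exact_mod_cast hs1
    have t0 := tau_nonneg s
    have t1 := tau_nonneg m
    have vt := vt_nonneg hX s
    have q0 : 0 ≤ (if Squarefree s ∧ T < (s : ℝ) then v X s * tau s ^ 3 / s else 0) := by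
      split_ifs
      · exact vt
      · exact le_rfl
    have e0 : (m : ℝ) ^ (-(3 / 2) : ℝ) * (m : ℝ) ^ (-(1 / 2) : ℝ) = 1 / (m : ℝ) ^ 2 := by
      have e1 : (m : ℝ) ^ (-(3 / 2) : ℝ) * (m : ℝ) ^ (-(1 / 2) : ℝ) = (m : ℝ) ^ (-(2 : ℕ) : ℝ) := by
        rw [← Real.rpow_add hm0]; norm_num
      rw [e1, Real.rpow_neg hm0.le, Real.rpow_natCast, one_div]
    simp only [F]
    split_ifs with h1 h2
    · refine le_add_of_le_of_nonneg ?_ (by positivity)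
      refine mul_le_mul_of_nonneg_left ?_ vt
      rw [div_eq_mul_one_div, ← e0]
      have : (m : ℝ) ^ (-(1 / 2) : ℝ) ≤ 1 :=
        Real.rpow_le_one_of_one_le_of_nonpos hm1' (by norm_num)
      have : (m : ℝ) ^ (-(3 / 2) : ℝ) * (m : ℝ) ^ (-(1 / 2) : ℝ) ≤ (m : ℝ) ^ (-(3 / 2) : ℝ) :=
        mul_le_of_le_one_right (by positivity) this
      gcongr
    · have hsT : (s : ℝ) ≤ T := by
        by_contra hc; exact h2 ⟨h1.1, not_le.mp hc⟩
      have hmE : E ^ 4 < (m : ℝ) ^ 2 := by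
        by_contra hc
        have hc := not_lt.mp hc
        have : (s : ℝ) * (m : ℝ) ^ 2 ≤ T * E ^ 4 := mul_le_mul hsT hc (by positivity) (by linarith)
        linarith [h1.2]
      have hmE2 : E ^ 2 ≤ m := by
        by_contra hc
        have hc := not_le.mp hc
        have := pow_lt_pow_left₀ hc hm0.le (n := 2) (by norm_num)
        rw [← pow_mul] at this
        norm_num at this; linarith
      have hmE3 : (m : ℝ) ^ (-(1 / 2) : ℝ) ≤ 1 / E := by
        rw [Real.rpow_neg hm0.le, ← Real.sqrt_eq_rpow, ← one_div]
        apply one_div_le_one_div_of_le (by linarith)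
        exact Real.le_sqrt_of_sq_le hmE2
      rw [zero_mul, zero_add]
      have a1 : v X s * tau s ^ 3 / s ≤ tau s ^ 4 / s := by
        have := v_le_tau hX s
        refine div_le_div_of_nonneg_right ?_ hs0.le
        calc v X s * tau s ^ 3 ≤ tau s * tau s ^ 3 := by gcongr
          _ = _ := by ring
      have a2 : tau m ^ 8 / (m : ℝ) ^ 2 ≤ tau m ^ 8 * (m : ℝ) ^ (-(3 / 2) : ℝ) / E := by
        rw [div_eq_mul_one_div, ← e0, div_eq_mul_one_div (_ * _) E, mul_assoc]
        gcongr
      exact mul_le_mul a1 a2 (by positivity) (by positivity)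
    · positivity
    · positivity
  refine step1.trans ((Finset.sum_le_sum step2).trans ?_)
  rw [Finset.sum_add_distrib, Finset.sum_product, Finset.sum_product]
  dsimp only
  have k1 := tau32_le N
  have k2 : ∑ n ∈ Icc 1 N, tau n ^ 4 / n ≤ HH N ^ 16 := tau_sum_le N 4
  have k3 := SM_nonneg hX T N
  have k4 : 0 ≤ ∑ m ∈ Icc 1 N, tau m ^ 8 * (m : ℝ) ^ (-(3 / 2) : ℝ) :=
    Finset.sum_nonneg fun m _ => by have := tau_nonneg m; positivity
  have k5 : 0 ≤ ∑ n ∈ Icc 1 N, tau n ^ 4 / n :=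
    Finset.sum_nonneg fun m _ => by have := tau_nonneg m; positivity
  refine add_le_add ?_ ?_
  · rw [mul_comm KS]
    refine le_trans (le_of_eq ?_) (mul_le_mul_of_nonneg_left k1 k3)
    unfold SM
    rw [Finset.sum_mul_sum]
  · have hE0 : (0 : ℝ) < E := by linarith
    have k6 : (∑ m ∈ Icc 1 N, tau m ^ 8 * (m : ℝ) ^ (-(3 / 2) : ℝ)) / E ≤ KS / E :=
      div_le_div_of_nonneg_right k1 hE0.le
    have k7 := mul_le_mul k2 k6 (div_nonneg k4 hE0.le) (k5.trans k2)
    rw [mul_comm (KS / E)]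
    refine le_trans (le_of_eq ?_) k7
    rw [Finset.sum_div, Finset.sum_mul_sum]

lemma HH_nonneg (N : ℕ) : 0 ≤ HH N := Finset.sum_nonneg fun i _ => by positivity

/-- numerical assembly -/
lemma assemble (hX : RC X) (M N : ℕ) (e l i c : ℝ) (he : 1 ≤ e) (hl : 1 ≤ l) (hi : i * l = 1)
    (hc : 1 ≤ c)
    (hM : e ^ 60 * e ^ 4 ≤ M) (hei : 1 / e ≤ i ^ 2023) (hH : HH N ≤ c * l)
    (hR : RR X (e ^ 20) N ≤ 50 * i ^ 2021) :
    ∑ n ∈ Ioc M N, v X n ^ 2 * tau n ^ 2 / n ≤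
      (KS * (400 * c ^ 14 + (50 + c ^ 256) ^ 2) + KS * c ^ 16) * i ^ 2007 := by
  have hl0 : 0 < l := by linarith
  have hi0 : 0 < i := by
    by_contra h
    nlinarith
  have hi1 : i ≤ 1 := by nlinarith
  have cancel : ∀ a b : ℕ, l ^ a * i ^ (a + b) = i ^ b := by
    intro a b
    rw [pow_add, ← mul_assoc, ← mul_pow, mul_comm l i, hi, one_pow, one_mul]
  have hY : (1 : ℝ) ≤ e ^ 20 := one_le_pow₀ he
  have hH0 := HH_nonneg N
  have hR0 := RR_nonneg hX (e ^ 20) N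
  have hV : HV X N ≤ (c * l) ^ 2 := (HV_le hX N).trans (pow_le_pow_left₀ hH0 hH 2)
  have hV7 : HV X N ^ 7 ≤ ((c * l) ^ 2) ^ 7 := pow_le_pow_left₀ (HV_nonneg hX N) hV 7
  have m1 : RR X (e ^ 20) N * HV X N ^ 7 ≤ 50 * c ^ 14 * i ^ 2007 := by
    calc _ ≤ (50 * i ^ 2021) * ((c * l) ^ 2) ^ 7 :=
          mul_le_mul hR hV7 (pow_nonneg (HV_nonneg hX N) _) (by positivity)
      _ = 50 * c ^ 14 * (l ^ 14 * i ^ (14 + 2007)) := by rw [← pow_mul, mul_pow]; ring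
      _ = _ := by rw [cancel]
  have q : QQ X (e ^ 20) N ≤ (50 + c ^ 256) * i ^ 1044 := by
    have h := QQ_le hX (e ^ 20) (l ^ 325) (by positivity) N
    have h1 : (l ^ 325) ^ 3 * RR X (e ^ 20) N ≤ 50 * i ^ 1044 := by
      calc _ ≤ (l ^ 325) ^ 3 * (50 * i ^ 2021) := by gcongr
        _ = 50 * (l ^ 975 * i ^ (975 + 1046)) := by rw [← pow_mul]; ring
        _ = 50 * i ^ 1046 := by rw [cancel]
        _ ≤ 50 * i ^ 1044 := by
          have := pow_le_pow_of_le_one hi0.le hi1 (show 1044 ≤ 1046 by norm_num)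
          linarith
    have h2 : HH N ^ 256 / (l ^ 325) ^ 4 ≤ c ^ 256 * i ^ 1044 := by
      rw [div_le_iff₀ (by positivity)]
      calc HH N ^ 256 ≤ (c * l) ^ 256 := pow_le_pow_left₀ hH0 hH _
        _ = c ^ 256 * l ^ 256 := mul_pow _ _ _
        _ = c ^ 256 * (l ^ 256 * (l ^ 1044 * i ^ (1044 + 0))) := by rw [cancel 1044 0]; ring
        _ = _ := by rw [← pow_mul, show 325 * 4 = 256 + 1044 by norm_num, pow_add l]; ring
    linarith
  have q2 : QQ X (e ^ 20) N ^ 2 ≤ (50 + c ^ 256) ^ 2 * i ^ 2007 := by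
    calc _ ≤ ((50 + c ^ 256) * i ^ 1044) ^ 2 := pow_le_pow_left₀ (QQ_nonneg hX _ _) q 2
      _ = (50 + c ^ 256) ^ 2 * i ^ 2088 := by rw [mul_pow, ← pow_mul]
      _ ≤ _ := by
        have := pow_le_pow_of_le_one hi0.le hi1 (show 2007 ≤ 2088 by norm_num)
        exact mul_le_mul_of_nonneg_left this (by positivity)
  have sm := SM_le hX (e ^ 20) hY N
  have e60 : e ^ 20 * e ^ 20 * e ^ 20 = e ^ 60 := by ring
  rw [e60] at sm
  have tot := total hX M N (e ^ 60) e he hM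
  have sm' : SM X (e ^ 60) N ≤ (400 * c ^ 14 + (50 + c ^ 256) ^ 2) * i ^ 2007 := by
    rw [add_mul]; linarith
  have t2 : KS / e * HH N ^ 16 ≤ KS * c ^ 16 * i ^ 2007 := by
    calc KS / e * HH N ^ 16 = KS * ((1 / e) * HH N ^ 16) := by ring
      _ ≤ KS * (i ^ 2023 * (c * l) ^ 16) := by
        refine mul_le_mul_of_nonneg_left ?_ KS_nonneg
        exact mul_le_mul hei (pow_le_pow_left₀ hH0 hH _) (by positivity) (by positivity)
      _ = KS * c ^ 16 * (l ^ 16 * i ^ (16 + 2007)) := by rw [mul_pow]; ring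
      _ = _ := by rw [cancel]
  have t1 := mul_le_mul_of_nonneg_left sm' KS_nonneg
  rw [add_mul]
  linarith

end Aux3

namespace Aux3
open Finset

lemma ev_log : ∃ D₀ : ℕ, ∀ D : ℕ, D₀ ≤ D → Real.log D ^ 2023 ≤ (D : ℝ) ^ (1 / 16 : ℝ) := by
  have h := (isLittleO_log_rpow_rpow_atTop (s := 1 / 16) ((2023 : ℕ) : ℝ) (by norm_num)).bound
    (c := 1) one_pos
  have h2 := (tendsto_natCast_atTop_atTop (R := ℝ)).eventually h
  obtain ⟨D₀, hD⟩ := Filter.eventually_atTop.mp h2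
  refine ⟨D₀, fun D h => ?_⟩
  have := hD D h
  simp only [Real.rpow_natCast, Real.norm_eq_abs, one_mul] at this
  refine (le_abs_self _).trans (this.trans_eq (abs_of_nonneg (by positivity)))

lemma HH_le (D : ℕ) (h : 1 ≤ Real.log D) : HH (D ^ 8) ≤ 9 * Real.log D := by
  have h1 := harmonic_le_one_add_log (D ^ 8)
  rw [harmonic_eq_sum_Icc] at h1
  push_cast at h1
  rw [Real.log_pow] at h1
  unfold HH
  simp only [one_div]
  push_cast at h1
  linarith

lemma RR_le {X : ℕ → ℝ} (hX : RC X) (D N : ℕ) (hD : 0 < D) (e l i L : ℝ) (he : 1 ≤ e)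
    (heD : e ^ 16 = D) (hl : 1 ≤ l) (hi : i * l = 1) (hei : 1 / e ≤ i ^ 2023)
    (hS : ∀ a b, |∑ d ∈ Ioc a b, X d| ≤ D)
    (hL : ∀ U : ℕ, 0 < U → ∑ d ∈ Icc 1 U, X d / d ≤ L + D / U)
    (hLl : L ≤ i ^ 2022) (hH : HH N ≤ 9 * l) :
    RR X (e ^ 20) N ≤ 50 * i ^ 2021 := by
  have he0 : 0 < e := by linarith
  have hi0 : 0 < i := by
    by_contra hc
    have := mul_nonneg (sub_nonneg.2 (not_lt.1 hc)) (by linarith : (0:ℝ) ≤ l)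
    nlinarith
  have hi1 : i ≤ 1 := by nlinarith
  have hκ : ∀ n : ℕ, e ^ 20 < (n : ℝ) → W X n ≤ (5 * i ^ 2022) * n := by
    intro n hn
    have hn0 : (0 : ℝ) < n := lt_trans (by positivity) hn
    have h1 := W_le' hX n D (by exact_mod_cast hn0) hD L hS hL
    have h2 : √((n : ℝ) * D) ≤ n * (1 / e) := by
      apply Real.sqrt_le_iff.mpr
      refine ⟨by positivity, ?_⟩
      have : (D : ℝ) ≤ n * (1 / e) ^ 2 := by
        rw [one_div, inv_pow, ← div_eq_mul_inv, le_div_iff₀ (by positivity), ← heD, ← pow_add]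
        exact (pow_le_pow_right₀ he (by norm_num)).trans hn.le
      calc (n : ℝ) * D ≤ n * (n * (1 / e) ^ 2) := by gcongr
        _ = _ := by ring
    have h3 : 1 / e ≤ i ^ 2022 :=
      hei.trans (pow_le_pow_of_le_one hi0.le hi1 (by norm_num))
    have h4 : (n : ℝ) * (1 / e) ≤ n * i ^ 2022 := by gcongr
    have h5 : (n : ℝ) * L ≤ n * i ^ 2022 := by gcongr
    generalize i ^ 2022 = j at *
    linarith
  have h := R_le hX (e ^ 20) (5 * i ^ 2022) (one_le_pow₀ he) (by positivity) hκ N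
  have h2 : 5 * i ^ 2022 * (1 + HH N) ≤ 5 * i ^ 2022 * (10 * l) := by
    gcongr; linarith
  have h3 : 5 * i ^ 2022 * (10 * l) = 50 * i ^ 2021 := by
    rw [pow_succ i 2021]
    generalize i ^ 2021 = j
    linear_combination 50 * j * hi
  unfold RR
  exact (h.trans h2).trans_eq h3

lemma final_bound : ∃ C : ℝ, 0 < C ∧ ∃ D₀ : ℕ, ∀ D : ℕ, D₀ ≤ D → D ≠ 0 → ∀ [NeZero D],
    ∀ χ : DirichletCharacter ℂ D, (∀ a, (χ a).im = 0) → χ.IsPrimitive →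
    (DirichletCharacter.LFunction χ 1).re < ((Real.log D)⁻¹) ^ 2022 →
      ∑ n ∈ Ioc (D ^ 4) (D ^ 8), v (XX χ) n ^ 2 * tau n ^ 2 / n
        ≤ C * ((Real.log D)⁻¹) ^ 2007 := by
  obtain ⟨c, hc9⟩ : ∃ c : ℝ, c = 9 := ⟨9, rfl⟩
  obtain ⟨D₁, hD₁⟩ := ev_log
  have hK := KS_nonneg
  have hc : 1 ≤ c := by rw [hc9]; norm_num
  have hc0 : 0 ≤ c := by linarith
  have hpos : 0 < (KS * (400 * c ^ 14 + (50 + c ^ 256) ^ 2) + KS * c ^ 16) + 1 := by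
    have h1 := pow_nonneg hc0 14
    have h2 := pow_nonneg hc0 16
    have h3 := sq_nonneg (50 + c ^ 256)
    have h4 := mul_nonneg hK (add_nonneg (mul_nonneg (by norm_num : (0 : ℝ) ≤ 400) h1) h3)
    have h5 := mul_nonneg hK h2
    exact add_pos_of_nonneg_of_pos (add_nonneg h4 h5) one_pos
  refine ⟨(KS * (400 * c ^ 14 + (50 + c ^ 256) ^ 2) + KS * c ^ 16) + 1, hpos,
    max D₁ 3, ?_⟩
  intro D hD hD0 _ χ hr hp hL
  have hD3 : 3 ≤ D := (le_max_right _ _).trans hD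
  have hD1 := hD₁ D ((le_max_left _ _).trans hD)
  have hDr : (3 : ℝ) ≤ D := by exact_mod_cast hD3
  have hDpos : (0 : ℝ) < D := by linarith
  have hl : 1 ≤ Real.log D := by
    rw [Real.le_log_iff_exp_le hDpos]
    linarith [Real.exp_one_lt_d9]
  obtain ⟨e, hedef⟩ : ∃ e : ℝ, e = (D : ℝ) ^ (1 / 16 : ℝ) := ⟨_, rfl⟩
  rw [← hedef] at hD1
  have he : 1 ≤ e := by
    rw [hedef]; exact Real.one_le_rpow (by linarith) (by norm_num)
  have heD : e ^ 16 = D := by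
    rw [hedef, ← Real.rpow_natCast, ← Real.rpow_mul hDpos.le]; norm_num
  have hHH := HH_le D hl
  generalize Real.log (D : ℝ) = l at *
  have hi : l⁻¹ * l = 1 := inv_mul_cancel₀ (by linarith)
  have hl0 : 0 < l := by linarith
  have hei : 1 / e ≤ l⁻¹ ^ 2023 := by
    rw [inv_pow, ← one_div]
    exact one_div_le_one_div_of_le (by positivity) hD1
  have hχ := ne_one_of_primitive χ (by omega) hp
  have hX := XX_RC χ hr
  have hR := RR_le hX D (D ^ 8) (by omega) e l l⁻¹ _ he heD hl hi hei
    (XX_sum χ hχ hr) (fun U hU => L_lower χ hχ hr U hU) hL.le hHH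
  have := assemble hX (D ^ 4) (D ^ 8) e l l⁻¹ c he hl hi hc
    (by push_cast; rw [← heD]; exact le_of_eq (by ring)) hei (by rw [hc9]; exact hHH) hR
  refine this.trans ?_
  exact mul_le_mul_of_nonneg_right (le_add_of_nonneg_right zero_le_one)
    (pow_nonneg (inv_nonneg.mpr hl0.le) _)

end Aux3

/-- Under (A), `∑_{D⁴ < n ≤ D⁸} ν(n)² τ₂(n)²/n ≤ C 𝓛^{-2007}`. -/
theorem statement3 :
    ∃ C : ℝ, 0 < C ∧ ∃ D₀ : ℕ, ∀ D : ℕ, D₀ ≤ D → ∀ χ : DirichletCharacter ℂ D,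
      IsRealChar χ → χ.IsPrimitive → AssumptionA D χ →
        (∑ n ∈ Finset.Ioc (D ^ 4) (D ^ 8),
            (nuF D χ n).re ^ 2 * (n.divisors.card : ℝ) ^ 2 / (n : ℝ)) ≤
          C * bigL D ^ (-2007 : ℤ) := by
  obtain ⟨C, hC, D₀, h⟩ := Aux3.final_bound
  refine ⟨C, hC, max D₀ 1, fun D hD χ hr hp hA => ?_⟩
  have hD0 : D ≠ 0 := by
    have := (le_max_right D₀ 1).trans hD
    omega
  haveI : NeZero D := ⟨hD0⟩
  have hA' : (DirichletCharacter.LFunction χ 1).re < ((Real.log D)⁻¹) ^ 2022 := by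
    unfold AssumptionA Lfun bigL at hA
    rw [dif_neg hD0] at hA
    refine hA.trans_eq ?_
    rw [inv_pow]
    exact zpow_neg_coe_of_pos _ (by norm_num)
  have key := h D ((le_max_left _ _).trans hD) hD0 χ hr hp hA'
  have e1 : bigL D ^ (-2007 : ℤ) = ((Real.log D)⁻¹) ^ 2007 := by
    rw [inv_pow]
    exact zpow_neg_coe_of_pos _ (by norm_num)
  rw [e1]
  refine le_trans (le_of_eq ?_) key
  refine Finset.sum_congr rfl fun n _ => ?_
  have e2 : (nuF D χ n).re = Aux3.v (Aux3.XX χ) n := by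
    unfold nuF Aux3.v Aux3.XX
    rw [Complex.re_sum]
  rw [e2]
  rfl

end
end
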